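/- Fix integers m, n ≥ 1 and d ∈ ℕ. (1) Every left operator among {B^L_i (i ∈ 𝕀_{2m−1}), (d^L_r)^{±1} (r ∈ {1/2,…,m−1/2})} commutes with every right operator among {B^R_i (i ∈ 𝕀_{2n−1}), (d^R_r)^{±1} (r ∈ {1/2,…,n−1/2})} as ℚ(q)-linear endomorphisms of 𝒱^ı_{m|n,d}. (2) The two commuting actions satisfy the double centralizer property: the commutant in End(𝒱^ı_{m|n,d}) of the unital subalgebra generated by the left operators equals the unital subalgebra generated by the right operators, and the commutant of the unital subalgebra generated by the right operators equals the unital subalgebra generated by the left operators. (This is the ıHowe duality between U^ı_m and U^ı_n on 𝒱^ı_{m|n,d}.) -/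

import Mathlib

open scoped BigOperators Classical

set_option synthInstance.maxHeartbeats 1000000
set_option maxHeartbeats 1000000

noncomputable section

/-- The base field `ℚ(q)`. -/
abbrev K : Type := RatFunc ℚ

/-- The indeterminate `q`. -/
def q : K := RatFunc.X

/-- The quantum integer `[r] = (q^r - q^{-r})/(q - q^{-1})`. -/
def qint (r : ℤ) : K := (q ^ r - q ^ (-r)) / (q - q⁻¹)

/-- The quantum factorial `[r]!`. -/
def qfac : ℕ → K
  | 0 => 1
  | n+1 => qfac n * qint (n+1)

/-- The index set `𝕀_N = {-(N-1)/2, -(N-3)/2, …, (N-1)/2}` as a finite set of rationals. -/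
def II (N : ℕ) : Finset ℚ := (Finset.range N).image (fun k : ℕ => (k : ℚ) - ((N : ℚ) - 1) / 2)

theorem II_neg {N : ℕ} {a : ℚ} (h : a ∈ II N) : -a ∈ II N := by
  obtain ⟨k, hk, hv⟩ := Finset.mem_image.mp h
  rw [Finset.mem_range] at hk
  refine Finset.mem_image.mpr ⟨N - 1 - k, Finset.mem_range.mpr (by omega), ?_⟩
  have h1 : ((N - 1 - k : ℕ) : ℚ) = (N : ℚ) - 1 - (k : ℚ) := by
    have h2 : (N : ℚ) = ((N - 1 - k : ℕ) : ℚ) + (k : ℚ) + 1 := by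
      exact_mod_cast congrArg (Nat.cast : ℕ → ℚ) (by omega : N = (N - 1 - k) + k + 1)
    linarith
  rw [h1, ← hv]; ring

/-- Matrices with rational row/column labels and natural number entries. -/
abbrev Mat : Type := ℚ → ℚ → ℕ

/-- The θ-elementary matrix `E^θ_{r,c} = E_{r,c} + E_{-r,-c}`. -/
def chiM (r c : ℚ) : Mat := fun x y =>
  (if x = r ∧ y = c then 1 else 0) + (if x = -r ∧ y = -c then 1 else 0)

/-- `A + E^θ_{p,j} - E^θ_{p',j'}` (truncated ℕ-subtraction; only used where the
corresponding q-integer coefficient vanishes otherwise). -/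
def matMove (A : Mat) (p j p' j' : ℚ) : Mat := fun x y => A x y + chiM p j x y - chiM p' j' x y

/-- Free `ℚ(q)`-vector space on the set of matrices `P`. -/
abbrev FM (P : Set Mat) : Type := {A : Mat // A ∈ P} →₀ K

/-- Basis vector `t^{(A)}` (zero if `A ∉ P`). -/
def tP (P : Set Mat) (A : Mat) : FM P := if h : A ∈ P then Finsupp.single ⟨A, h⟩ 1 else 0

/-- Linear operator on `FM P` defined by its values on basis vectors. -/
def opOf {P : Set Mat} (f : Mat → FM P) : FM P →ₗ[K] FM P :=
  Finsupp.lift (FM P) K {A : Mat // A ∈ P} fun A => f A.1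

/-- The set `Ξ^ı_{m|n,d}`: matrices supported on `𝕀_{2m} × 𝕀_{2n}`, centro-symmetric,
with total entry sum `2d`. -/
def Xiι (m n d : ℕ) : Set Mat :=
  {A | (∀ i j, A i j ≠ 0 → i ∈ II (2*m) ∧ j ∈ II (2*n)) ∧
       (∀ i j, A i j = A (-i) (-j)) ∧
       ∑ i ∈ II (2*m), ∑ j ∈ II (2*n), A i j = 2*d}

/-- Left operator `B^L_i` (ı-case), for `i ∈ 𝕀_{2m-1}`, `i ≠ 0`. -/
def BLι (n : ℕ) (P : Set Mat) (i : ℚ) : FM P →ₗ[K] FM P :=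
  opOf fun A => ∑ j ∈ II (2*n),
    (q ^ ((∑ k ∈ (II (2*n)).filter (fun k => j ≤ k), ((A (i+1/2) k : ℤ) - (A (i-1/2) k : ℤ))) + 1)
      * qint (A (i-1/2) j)) • tP P (matMove A (i+1/2) j (i-1/2) j)

/-- Left operator `B^L_0` (ı-case). -/
def BL0ι (n : ℕ) (P : Set Mat) : FM P →ₗ[K] FM P :=
  opOf fun A =>
    (∑ j ∈ II (2*n),
      (q ^ ((∑ k ∈ (II (2*n)).filter (fun k => j ≤ k), ((A (1/2) k : ℤ) - (A (-(1/2)) k : ℤ)))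
            + (if 0 < j then 1 else 0))
        * qint (A (-(1/2)) j)) • tP P (matMove A (1/2) j (-(1/2)) j))
    + (q ^ (∑ j ∈ (II (2*n)).filter (fun j => 0 < j), ((A (1/2) j : ℤ) - (A (-(1/2)) j : ℤ)))) • tP P A

/-- Left Cartan operator `(d^L_r)^e` for `e = ±1` (ı-case). -/
def dLι (n : ℕ) (P : Set Mat) (r : ℚ) (e : ℤ) : FM P →ₗ[K] FM P :=
  opOf fun A => (q ^ (e * ∑ j ∈ II (2*n), (A r j : ℤ))) • tP P A

/-- Right operator `B^R_i` (ı-case), for `i ∈ 𝕀_{2n-1}`, `i ≠ 0`. -/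
def BRι (m : ℕ) (P : Set Mat) (i : ℚ) : FM P →ₗ[K] FM P :=
  opOf fun A => ∑ j ∈ II (2*m),
    (q ^ (∑ k ∈ (II (2*m)).filter (fun k => j < k), ((A k (i+1/2) : ℤ) - (A k (i-1/2) : ℤ)))
      * qint (A j (i+1/2))) • tP P (matMove A j (i-1/2) j (i+1/2))

/-- Right operator `B^R_0` (ı-case). -/
def BR0ι (m : ℕ) (P : Set Mat) : FM P →ₗ[K] FM P :=
  opOf fun A =>
    (∑ j ∈ II (2*m),
      (q ^ ((∑ k ∈ (II (2*m)).filter (fun k => j < k), ((A k (1/2) : ℤ) - (A k (-(1/2)) : ℤ)))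
            + (if j < 0 then 1 else 0))
        * qint (A j (1/2))) • tP P (matMove A j (-(1/2)) j (1/2)))
    + (q ^ (∑ j ∈ (II (2*m)).filter (fun j => 0 < j), ((A j (1/2) : ℤ) - (A j (-(1/2)) : ℤ)))) • tP P A

/-- Right Cartan operator `(d^R_r)^e` for `e = ±1` (ı-case). -/
def dRι (m : ℕ) (P : Set Mat) (r : ℚ) (e : ℤ) : FM P →ₗ[K] FM P :=
  opOf fun A => (q ^ (e * ∑ k ∈ II (2*m), (A k r : ℤ))) • tP P A

/-- The generating set of left operators on `𝒱^ı_{m|n,d}`: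
`B^L_i` (`i ∈ 𝕀_{2m-1}`) and `(d^L_r)^{±1}` (`r ∈ {1/2,…,m-1/2}`). -/
def gensLι (m n d : ℕ) : Set (Module.End K (FM (Xiι m n d))) :=
  {O | (∃ i ∈ II (2*m - 1), O = if i = 0 then BL0ι n (Xiι m n d) else BLι n (Xiι m n d) i)
     ∨ (∃ r ∈ II (2*m), 0 < r ∧ (O = dLι n (Xiι m n d) r 1 ∨ O = dLι n (Xiι m n d) r (-1)))}

/-- The generating set of right operators on `𝒱^ı_{m|n,d}`:
`B^R_i` (`i ∈ 𝕀_{2n-1}`) and `(d^R_r)^{±1}` (`r ∈ {1/2,…,n-1/2}`). -/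
def gensRι (m n d : ℕ) : Set (Module.End K (FM (Xiι m n d))) :=
  {O | (∃ i ∈ II (2*n - 1), O = if i = 0 then BR0ι m (Xiι m n d) else BRι m (Xiι m n d) i)
     ∨ (∃ r ∈ II (2*n), 0 < r ∧ (O = dRι m (Xiι m n d) r 1 ∨ O = dRι m (Xiι m n d) r (-1)))}


section Bicommutant

open Module

variable {k V : Type*} [Field k] [AddCommGroup V] [Module k V]

/-- A subalgebra of endomorphisms which is stable under adjoints with respect to an anisotropic
symmetric form acts semisimply. -/
theorem isSemisimpleModule_of_adjoint [FiniteDimensional k V] (B : LinearMap.BilinForm k V)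
    (hsymm : ∀ u v, B u v = B v u) (hB : ∀ v, B v v = 0 → v = 0)
    (E : Subalgebra k (End k V)) (hE : ∀ a ∈ E, ∃ b ∈ E, ∀ u v, B (a u) v = B u (b v)) :
    IsSemisimpleModule E V where
  exists_isCompl N := by
    let N' : Submodule k V := N.restrictScalars k
    have hdisj : Disjoint N' (B.orthogonal N') := by
      rw [Submodule.disjoint_def]
      exact fun x hx hx' => hB x (hx' x hx)
    have hrefl : B.IsRefl := fun x y h => by rw [hsymm]; exact h
    have hc := (LinearMap.BilinForm.isCompl_orthogonal_iff_disjoint hrefl).2 hdisj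
    let M : Submodule E V :=
      { carrier := B.orthogonal N'
        add_mem' := fun h1 h2 => (B.orthogonal N').add_mem h1 h2
        zero_mem' := (B.orthogonal N').zero_mem
        smul_mem' := by
          rintro ⟨a, ha⟩ x hx y hy
          obtain ⟨b, hb, hab⟩ := hE a ha
          change B y (a x) = 0
          rw [hsymm, hab, hsymm]
          exact hx _ (N.smul_mem ⟨b, hb⟩ hy) }
    refine ⟨M, ?_⟩
    rw [isCompl_iff, Submodule.disjoint_def, Submodule.codisjoint_iff_exists_add_eq]
    refine ⟨fun x hx hx' => hB x (hx' x hx), fun x => ?_⟩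
    obtain ⟨y, z, hy, hz, h⟩ := (Submodule.codisjoint_iff_exists_add_eq.1 hc.codisjoint) x
    exact ⟨y, z, hy, hz, h⟩

/-- The bicommutant theorem for subalgebras acting semisimply. -/
theorem centralizer_centralizer_of_isSemisimpleModule [FiniteDimensional k V]
    (E : Subalgebra k (End k V))
    [IsSemisimpleModule E V] :
    Subalgebra.centralizer k
      ((Subalgebra.centralizer k (E : Set (End k V)) : Subalgebra k (End k V)) :
        Set (End k V)) = E := by
  refine le_antisymm (fun b hb => ?_) (fun a ha => ?_)
  · rw [Subalgebra.mem_centralizer_iff] at hb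
    have hcomm : ∀ (g : End E V) (v : V), b (g v) = g (b v) := by
      intro g v
      have hg : g.restrictScalars k ∈ Subalgebra.centralizer k (E : Set (End k V)) := by
        rw [Subalgebra.mem_centralizer_iff]
        intro a ha
        ext w
        exact (g.map_smul ⟨a, ha⟩ w).symm
      exact (LinearMap.congr_fun (hb _ hg) v).symm
    let f : End (End E V) V :=
      { toFun := b
        map_add' := b.map_add
        map_smul' := hcomm }
    let bs := Module.finBasis k V
    obtain ⟨r, hr⟩ := jacobson_density f (Finset.univ.image bs)
    have : b = r.1 := by
      refine bs.ext fun i => ?_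
      exact hr (bs i) (Finset.mem_image_of_mem _ (Finset.mem_univ i))
    rw [this]
    exact r.2
  · rw [Subalgebra.mem_centralizer_iff]
    intro g hg
    exact ((Subalgebra.mem_centralizer_iff k).1 hg a ha).symm

theorem exists_adjoint_of_mem_adjoin (B : LinearMap.BilinForm k V)
    (S : Set (End k V))
    (hS : ∀ a ∈ S, ∃ b ∈ Algebra.adjoin k S, ∀ u v, B (a u) v = B u (b v))
    {a : End k V} (ha : a ∈ Algebra.adjoin k S) :
    ∃ b ∈ Algebra.adjoin k S, ∀ u v, B (a u) v = B u (b v) := by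
  induction ha using Algebra.adjoin_induction with
  | mem x hx => exact hS x hx
  | algebraMap r =>
    exact ⟨_, Subalgebra.algebraMap_mem _ r, fun u v => by
      simp [Module.algebraMap_end_apply]⟩
  | add x y hx hy h1 h2 =>
    obtain ⟨b, hb, h1⟩ := h1
    obtain ⟨c, hc, h2⟩ := h2
    exact ⟨b + c, add_mem hb hc, fun u v => by simp [h1, h2]⟩
  | mul x y hx hy h1 h2 =>
    obtain ⟨b, hb, h1⟩ := h1
    obtain ⟨c, hc, h2⟩ := h2
    exact ⟨c * b, mul_mem hc hb, fun u v => by simp [Module.End.mul_apply, h1, h2]⟩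

end Bicommutant

theorem exists_ringHom_real_pos : ∃ φ : K →+* ℝ, 1 < φ q := by
  have htr : Transcendental ℚ (liouvilleNumber 2 + 2) := by
    have h := transcendental_liouvilleNumber (m := 2) le_rfl
    have h2 : Transcendental ℚ (liouvilleNumber 2) :=
      fun hh => h ((IsFractionRing.isAlgebraic_iff ℤ ℚ ℝ).2 hh)
    intro hh
    apply h2
    have := hh.sub (isAlgebraic_algebraMap (2 : ℚ))
    simpa using this
  have hinj : Function.Injective (Polynomial.aeval (R := ℚ) (liouvilleNumber 2 + 2 : ℝ)) :=
    transcendental_iff_injective.1 htr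
  let ψ : Polynomial ℚ →+* ℝ := (Polynomial.aeval (R := ℚ) (liouvilleNumber 2 + 2 : ℝ)).toRingHom
  have hψ := nonZeroDivisors_le_comap_nonZeroDivisors_of_injective ψ hinj
  refine ⟨RatFunc.liftRingHom ψ hψ, ?_⟩
  have hpos : (0 : ℝ) ≤ liouvilleNumber 2 := by
    unfold liouvilleNumber
    exact tsum_nonneg fun i => by positivity
  have h : RatFunc.liftRingHom ψ hψ q = liouvilleNumber 2 + 2 := by
    simp [q, ψ]
  rw [h]
  linarith

theorem q_ne_zero : q ≠ 0 := RatFunc.X_ne_zero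

theorem q_zpow_injective : Function.Injective fun k : ℤ => q ^ k := by
  obtain ⟨φ, hφ⟩ := exists_ringHom_real_pos
  intro a b h
  have h' : φ q ^ a = φ q ^ b := by
    simpa [map_zpow₀] using congrArg φ h
  exact zpow_right_injective₀ (by linarith) hφ.ne' h'

theorem q_sub_inv_ne_zero : q - q⁻¹ ≠ 0 := by
  intro h
  have := @q_zpow_injective 1 (-1) (by simpa using sub_eq_zero.1 h)
  omega

theorem qint_zero : qint 0 = 0 := by simp [qint]


section IntegerModel

/-- Integer matrices with integer row and column labels; the label `x` stands for `x + 1/2`. -/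
abbrev ZMat : Type := ℤ → ℤ → ℤ

/-- The centro-symmetric nonnegative matrices supported on `[-m, m) × [-n, n)` with entry
sum `2d`. -/
structure IsXi (m n d : ℕ) (a : ZMat) : Prop where
  nonneg : ∀ x y, 0 ≤ a x y
  supp : ∀ x y, a x y ≠ 0 → ((-m : ℤ) ≤ x ∧ x < m) ∧ ((-n : ℤ) ≤ y ∧ y < n)
  symm : ∀ x y, a x y = a (-1 - x) (-1 - y)
  total : ∑ x ∈ Finset.Ico (-m : ℤ) m, ∑ y ∈ Finset.Ico (-n : ℤ) n, a x y = 2 * d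

abbrev XiZ (m n d : ℕ) : Type := {a : ZMat // IsXi m n d a}

abbrev VZ (m n d : ℕ) : Type := XiZ m n d →₀ K

/-- The basis vector indexed by `a`, zero if `a` is not an index. -/
def tZ (m n d : ℕ) (a : ZMat) : VZ m n d :=
  if h : IsXi m n d a then Finsupp.single ⟨a, h⟩ 1 else 0

/-- The centro-symmetric elementary matrix. -/
def chiZ (r c : ℤ) : ZMat := fun x y =>
  (if x = r ∧ y = c then 1 else 0) + (if x = -1 - r ∧ y = -1 - c then 1 else 0)

/-- The change of a matrix when a unit of row `x` moves from column `i` to column `i - 1`. -/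
def moveZ (i x : ℤ) : ZMat := chiZ x (i - 1) - chiZ x i

def trMat (a : ZMat) : ZMat := fun x y => a y x

def opZ {m n d : ℕ} (f : ZMat → VZ m n d) : Module.End K (VZ m n d) :=
  Finsupp.lift (VZ m n d) K (XiZ m n d) fun a => f a.1

/-- The exponent of `q` in the term of index `x` of the `i`-th operator. -/
def wtZ (m : ℕ) (i : ℤ) (a : ZMat) (x : ℤ) : ℤ :=
  (∑ z ∈ Finset.Ioo x m, (a z i - a z (i - 1))) + if i = 0 ∧ x < 0 then 1 else 0

/-- The exponent of `q` in the diagonal term of the operator of index `0`. -/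
def wtDiagZ (m : ℕ) (a : ZMat) : ℤ := ∑ z ∈ Finset.Ico (0 : ℤ) m, (a z 0 - a z (-1))

/-- The coefficients of the `i`-th operator; the index `none` is the diagonal term. -/
def coefZ (m : ℕ) (i : ℤ) : Option ℤ → ZMat → K
  | none, a => if i = 0 then q ^ wtDiagZ m a else 0
  | some x, a => q ^ wtZ m i a x * qint (a x i)

/-- The displacements of the `i`-th operator; the index `none` is the diagonal term. -/
def stepZ (i : ℤ) : Option ℤ → ZMat
  | none => 0
  | some x => moveZ i x

def idxZ (m : ℕ) : Finset (Option ℤ) := Finset.insertNone (Finset.Ico (-m : ℤ) m)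

/-- The right operator `B_i` in integer labels. -/
def RZ (m n d : ℕ) (i : ℤ) : Module.End K (VZ m n d) :=
  opZ fun a => ∑ o ∈ idxZ m, coefZ m i o a • tZ m n d (a + stepZ i o)

/-- The sum of the entries of a column. -/
def colZ (m : ℕ) (a : ZMat) (r : ℤ) : ℤ := ∑ x ∈ Finset.Ico (-m : ℤ) m, a x r

/-- The operator scaling the basis vector of index `a` by `g a`. -/
def diagZ (m n d : ℕ) (g : ZMat → K) : Module.End K (VZ m n d) :=
  opZ fun a => g a • tZ m n d a

/-- The right Cartan operator `d_r ^ e` in integer labels. -/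
def CZ (m n d : ℕ) (r e : ℤ) : Module.End K (VZ m n d) :=
  diagZ m n d fun a => q ^ (e * colZ m a r)

def gensZ (m n d : ℕ) : Set (Module.End K (VZ m n d)) :=
  {O | (∃ i : ℤ, -n < i ∧ i < n ∧ O = RZ m n d i) ∨
    (∃ r : ℤ, 0 ≤ r ∧ r < n ∧ (O = CZ m n d r 1 ∨ O = CZ m n d r (-1)))}

variable {m n d : ℕ}

theorem tZ_of_isXi {a : ZMat} (h : IsXi m n d a) : tZ m n d a = Finsupp.single ⟨a, h⟩ 1 :=
  dif_pos h

theorem opZ_tZ (f : ZMat → VZ m n d) {a : ZMat} (h : IsXi m n d a) :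
    opZ f (tZ m n d a) = f a := by
  simp [opZ, tZ_of_isXi h]

theorem linearMap_ext_tZ {W : Type*} [AddCommGroup W] [Module K W]
    {f g : VZ m n d →ₗ[K] W} (h : ∀ a, IsXi m n d a → f (tZ m n d a) = g (tZ m n d a)) :
    f = g := by
  refine Finsupp.lhom_ext fun a b => ?_
  have h' := h a.1 a.2
  rw [tZ_of_isXi a.2] at h'
  have : (Finsupp.single a b : VZ m n d) = b • Finsupp.single a 1 := by simp
  rw [this, map_smul, map_smul]
  exact congrArg _ h'

theorem sum_smul_tZ (v : VZ m n d) : v = v.sum fun a c => c • tZ m n d a.1 := by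
  conv_lhs => rw [← Finsupp.sum_single v]
  refine Finsupp.sum_congr fun a _ => ?_
  rw [tZ_of_isXi a.2]
  simp

theorem RZ_tZ (i : ℤ) {a : ZMat} (h : IsXi m n d a) :
    RZ m n d i (tZ m n d a) =
      ∑ o ∈ idxZ m, coefZ m i o a • tZ m n d (a + stepZ i o) := opZ_tZ _ h

theorem diagZ_tZ (g : ZMat → K) {a : ZMat} (h : IsXi m n d a) :
    diagZ m n d g (tZ m n d a) = g a • tZ m n d a := opZ_tZ _ h

theorem IsXi.nonneg_add_step {a : ZMat} (h : IsXi m n d a) {i x : ℤ} (hx : a x i ≠ 0) (u v : ℤ) :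
    0 ≤ (a + moveZ i x) u v := by
  have h1 := h.nonneg u v
  have h2 := h.nonneg x i
  have h3 := h.symm x i
  simp only [Pi.add_apply, moveZ, Pi.sub_apply, chiZ]
  by_cases c1 : u = x ∧ v = i
  · obtain ⟨rfl, rfl⟩ := c1
    have : ¬ (v = -1 - v) := by omega
    simp only [this, and_false, if_false, and_self, if_true]
    split_ifs <;> omega
  · by_cases c2 : u = -1 - x ∧ v = -1 - i
    · obtain ⟨rfl, rfl⟩ := c2
      rw [if_neg c1]
      simp only [and_self, if_true]
      split_ifs <;> omega
    · rw [if_neg c1, if_neg c2]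
      split_ifs <;> omega

theorem sum_sum_chiZ {r c : ℤ} (hr : (-m : ℤ) ≤ r ∧ r < m) (hc : (-n : ℤ) ≤ c ∧ c < n) :
    ∑ x ∈ Finset.Ico (-m : ℤ) m, ∑ y ∈ Finset.Ico (-n : ℤ) n, chiZ r c x y = 2 := by
  have key : ∀ r c : ℤ, ((-m : ℤ) ≤ r ∧ r < m) → ((-n : ℤ) ≤ c ∧ c < n) →
      ∑ x ∈ Finset.Ico (-m : ℤ) m, ∑ y ∈ Finset.Ico (-n : ℤ) n,
        (if x = r ∧ y = c then (1 : ℤ) else 0) = 1 := by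
    intro r c hr hc
    rw [Finset.sum_eq_single r, Finset.sum_eq_single c]
    · simp
    · intro b _ hb; simp [hb]
    · intro h; exact absurd (Finset.mem_Ico.2 hc) h
    · intro b _ hb; simp [hb]
    · intro h; exact absurd (Finset.mem_Ico.2 hr) h
  simp only [chiZ, Finset.sum_add_distrib]
  rw [key r c hr hc, key (-1 - r) (-1 - c) (by omega) (by omega)]
  rfl

theorem chiZ_ne_zero {r c u v : ℤ} (h : chiZ r c u v ≠ 0) :
    (u = r ∧ v = c) ∨ (u = -1 - r ∧ v = -1 - c) := by
  by_contra hcon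
  simp only [not_or] at hcon
  exact h (by rw [chiZ, if_neg hcon.1, if_neg hcon.2]; rfl)

theorem chiZ_symm (r c u v : ℤ) : chiZ r c u v = chiZ r c (-1 - u) (-1 - v) := by
  simp only [chiZ]
  rw [add_comm]
  congr 1 <;> refine if_congr ?_ rfl rfl <;> constructor <;> intro h <;> omega

theorem IsXi.add_chiZ_sub {a : ZMat} (h : IsXi m n d a) {r c r' c' : ℤ}
    (hr : (-m : ℤ) ≤ r ∧ r < m) (hc : (-n : ℤ) ≤ c ∧ c < n)
    (ha : a r' c' ≠ 0) (hnn : ∀ u v, 0 ≤ (a + (chiZ r c - chiZ r' c')) u v) :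
    IsXi m n d (a + (chiZ r c - chiZ r' c')) where
  nonneg := hnn
  supp u v huv := by
    by_contra hcon
    have h1 : a u v = 0 := by
      by_contra h'
      exact hcon (h.supp u v h')
    have h2 : chiZ r c u v = 0 := by
      by_contra h'
      apply hcon
      rcases chiZ_ne_zero h' with h' | h' <;> omega
    have h3 : chiZ r' c' u v = 0 := by
      by_contra h'
      apply hcon
      have := h.supp _ _ ha
      rcases chiZ_ne_zero h' with h' | h' <;> omega
    exact huv (by simp [h1, h2, h3])
  symm u v := by
    simp only [Pi.add_apply, Pi.sub_apply]
    rw [h.symm, chiZ_symm r c, chiZ_symm r' c']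
  total := by
    have h1 := h.supp _ _ ha
    simp only [Pi.add_apply, Pi.sub_apply, Finset.sum_add_distrib, Finset.sum_sub_distrib]
    rw [h.total, sum_sum_chiZ hr hc, sum_sum_chiZ h1.1 h1.2]
    ring

theorem IsXi.add_moveZ {a : ZMat} (h : IsXi m n d a) {i x : ℤ} (hi : (-n : ℤ) < i) (hi' : i < n)
    (hx : a x i ≠ 0) : IsXi m n d (a + moveZ i x) := by
  have hs := h.supp _ _ hx
  exact h.add_chiZ_sub hs.1 (by omega) hx (h.nonneg_add_step hx)

theorem IsXi.add_stepZ {a : ZMat} (h : IsXi m n d a) {i : ℤ} (hi : (-n : ℤ) < i) (hi' : i < n)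
    {o : Option ℤ} (ho : coefZ m i o a ≠ 0) : IsXi m n d (a + stepZ i o) := by
  cases o with
  | none => simpa [stepZ] using h
  | some x =>
    refine h.add_moveZ hi hi' fun h0 => ho ?_
    simp [coefZ, h0, qint_zero]

theorem IsXi.transpose {a : ZMat} (h : IsXi m n d a) : IsXi n m d (trMat a) where
  nonneg x y := h.nonneg y x
  supp x y hxy := (h.supp y x hxy).symm
  symm x y := h.symm y x
  total := by
    rw [Finset.sum_comm]
    exact h.total

def trEquiv (m n d : ℕ) : XiZ m n d ≃ XiZ n m d where
  toFun a := ⟨trMat a.1, a.2.transpose⟩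
  invFun a := ⟨trMat a.1, a.2.transpose⟩
  left_inv _ := rfl
  right_inv _ := rfl

/-- Transposition of matrices as a linear equivalence. -/
def trZ (m n d : ℕ) : VZ m n d ≃ₗ[K] VZ n m d := Finsupp.domLCongr (trEquiv m n d)

theorem isXi_trMat {a : ZMat} : IsXi n m d (trMat a) ↔ IsXi m n d a :=
  ⟨fun h => h.transpose, fun h => h.transpose⟩

theorem trZ_tZ (a : ZMat) : trZ m n d (tZ m n d a) = tZ n m d (trMat a) := by
  by_cases h : IsXi m n d a
  · rw [tZ_of_isXi h, tZ_of_isXi h.transpose, trZ, Finsupp.domLCongr_single]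
    rfl
  · have h' := mt (isXi_trMat (a := a)).1 h
    rw [tZ, tZ, dif_neg h, dif_neg h', map_zero]

theorem trZ_symm : (trZ m n d).symm = trZ n m d := by
  apply LinearEquiv.toLinearMap_injective
  refine linearMap_ext_tZ fun a _ => ?_
  change (trZ m n d).symm (tZ n m d a) = trZ n m d (tZ n m d a)
  rw [LinearEquiv.symm_apply_eq, trZ_tZ, trZ_tZ]
  rfl

/-- Conjugation by the transposition. -/
def trAlg (m n d : ℕ) : Module.End K (VZ m n d) ≃ₐ[K] Module.End K (VZ n m d) :=
  (trZ m n d).conjAlgEquiv K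

theorem trAlg_apply (f : Module.End K (VZ m n d)) (v : VZ n m d) :
    trAlg m n d f v = trZ m n d (f (trZ n m d v)) := by
  rw [← trZ_symm]
  rfl

theorem trAlg_trAlg (f : Module.End K (VZ m n d)) : trAlg n m d (trAlg m n d f) = f := by
  have h : ∀ v, trZ n m d (trZ m n d v) = v := fun v => by
    rw [← trZ_symm, LinearEquiv.symm_apply_apply]
  refine LinearMap.ext fun v => ?_
  rw [trAlg_apply, trAlg_apply, h, h]

end IntegerModel

section Commutation

variable {m n d : ℕ}

theorem qint_succ (c : ℤ) : qint (c + 1) = q * qint c + q ^ (-c) := by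
  have h := q_sub_inv_ne_zero
  have h0 := q_ne_zero
  rw [qint, qint, neg_add, zpow_add₀ h0, zpow_add₀ h0, zpow_one, zpow_neg_one]
  rw [mul_div_assoc', div_add' _ _ _ h]
  congr 1
  ring

theorem qint_succ' (c : ℤ) : qint (c + 1) = q⁻¹ * qint c + q ^ c := by
  have h := q_sub_inv_ne_zero
  have h0 := q_ne_zero
  rw [qint, qint, neg_add, zpow_add₀ h0, zpow_add₀ h0, zpow_one, zpow_neg_one]
  rw [mul_div_assoc', div_add' _ _ _ h]
  congr 1
  ring

theorem sum_ite_and_eq {s : Finset ℤ} (r : ℤ) (p : Prop) [Decidable p] :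
    ∑ z ∈ s, (if p ∧ z = r then (1 : ℤ) else 0) = if p ∧ r ∈ s then 1 else 0 := by
  by_cases hp : p <;> simp [hp]

/-- The change of the exponent `wtZ` under a row move. -/
def shiftZ (i j x y : ℤ) : ℤ :=
  (if x = j - 1 then (if y = i - 1 then 1 else 0) - (if y = i then 1 else 0) else 0) +
    (if x = -1 - j then (if y = -1 - i then 1 else 0) - (if y = -i then 1 else 0) else 0)

theorem trMat_add (a b : ZMat) : trMat (a + b) = trMat a + trMat b := rfl

theorem wtZ_add_trMat_moveZ (i : ℤ) {j : ℤ} (hj : (-m : ℤ) < j) (hj' : j < m) (a : ZMat)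
    (x y : ℤ) :
    wtZ m i (a + trMat (moveZ j y)) x = wtZ m i a x + shiftZ i j x y := by
  have : ∀ z c, (a + trMat (moveZ j y)) z c = a z c +
      (((if c = y ∧ z = j - 1 then 1 else 0) + (if c = -1 - y ∧ z = -1 - (j - 1) then 1 else 0)) -
      ((if c = y ∧ z = j then 1 else 0) + (if c = -1 - y ∧ z = -1 - j then 1 else 0))) :=
    fun z c => rfl
  simp only [wtZ, this, Finset.sum_sub_distrib, Finset.sum_add_distrib, sum_ite_and_eq,
    Finset.mem_Ioo, shiftZ]
  by_cases h1 : y = i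
  · subst h1
    by_cases h2 : y = 0
    · subst h2
      simp
      split_ifs <;> omega
    · have e1 : ¬ (y = -1 - y) := by omega
      have e2 : ¬ (y - 1 = y) := by omega
      have e3 : ¬ (y = y - 1) := by omega
      have e4 : ¬ (y - 1 = -1 - y) := by omega
      have e5 : ¬ (y = - y) := by omega
      simp only [e1, e2, e3, e4, e5, true_and, false_and, if_false]
      split_ifs <;> omega
  by_cases h2 : y = i - 1
  · subst h2
    by_cases h2 : i = 0
    · subst h2
      simp
      split_ifs <;> omega
    · have e1 : ¬ (i = -1 - (i - 1)) := by omega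
      have e2 : ¬ (i = i - 1) := by omega
      have e3 : ¬ (i - 1 = -1 - (i - 1)) := by omega
      have e4 : ¬ (i - 1 = i) := by omega
      have e5 : ¬ (i - 1 = - i) := by omega
      have e6 : ¬ (i - 1 = -1 - i) := by omega
      simp only [e1, e2, e3, e4, e5, e6, true_and, false_and, if_false, if_true]
      split_ifs <;> omega
  have e1 : ¬ (i = y) := fun h => h1 h.symm
  have e2 : ¬ (i - 1 = y) := fun h => h2 h.symm
  simp only [h1, h2, e1, e2, false_and, if_false]
  by_cases h3 : i = -1 - y
  · have f1 : y = -1 - i := by omega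
    have f2 : ¬ (i - 1 = -1 - y) := by omega
    have f3 : ¬ (y = - i) := by omega
    simp only [f2, f3, if_pos f1, if_false, false_and]
    simp only [← h3, true_and]
    split_ifs <;> omega
  by_cases h4 : i - 1 = -1 - y
  · have f1 : ¬ (y = -1 - i) := by omega
    have f3 : y = - i := by omega
    simp only [h3, f1, if_pos f3, if_false, false_and]
    simp only [← h4, true_and]
    split_ifs <;> omega
  have f1 : ¬ (y = -1 - i) := by omega
  have f3 : ¬ y = - i := by omega
  simp [h3, h4, f1, f3]

theorem wtZ_sub_one (i : ℤ) (a : ZMat) {x : ℤ} (hx : x < m) :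
    wtZ m i a (x - 1) =
      wtZ m i a x + (a x i - a x (i - 1)) + if i = 0 ∧ x = 0 then 1 else 0 := by
  have : Finset.Ioo (x - 1) (m : ℤ) = insert x (Finset.Ioo x m) := by
    ext z; simp only [Finset.mem_Ioo, Finset.mem_insert]; omega
  rw [wtZ, wtZ, this, Finset.sum_insert (by simp)]
  split_ifs <;> omega

theorem wtDiagZ_add_trMat_moveZ {j : ℤ} (hj : (-m : ℤ) < j) (hj' : j < m) (a : ZMat) (y : ℤ) :
    wtDiagZ m (a + trMat (moveZ j y)) = wtDiagZ m a +
      if j = 0 then 2 * ((if y = -1 then 1 else 0) - (if y = 0 then 1 else 0)) else 0 := by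
  have : ∀ z c, (a + trMat (moveZ j y)) z c = a z c +
      (((if c = y ∧ z = j - 1 then 1 else 0) + (if c = -1 - y ∧ z = -1 - (j - 1) then 1 else 0)) -
      ((if c = y ∧ z = j then 1 else 0) + (if c = -1 - y ∧ z = -1 - j then 1 else 0))) :=
    fun z c => rfl
  simp only [wtDiagZ, this, Finset.sum_sub_distrib, Finset.sum_add_distrib, sum_ite_and_eq,
    Finset.mem_Ico]
  by_cases h1 : y = 0
  · subst h1
    simp
    split_ifs <;> omega
  by_cases h2 : y = -1
  · subst h2
    simp
    split_ifs <;> omega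
  have e1 : ¬ (0 = y) := fun h => h1 h.symm
  have e2 : ¬ (-1 = y) := fun h => h2 h.symm
  have e3 : ¬ (0 = -1 - y) := by omega
  have e4 : ¬ (-1 = -1 - y) := by omega
  simp only [h1, h2, e1, e2, e3, e4, false_and, if_false]
  simp

theorem wtZ_zero_zero (hm : 1 ≤ m) (a : ZMat) :
    wtZ m 0 a 0 = wtDiagZ m a - (a 0 0 - a 0 (-1)) := by
  have : Finset.Ico (0 : ℤ) (m : ℤ) = insert 0 (Finset.Ioo 0 (m : ℤ)) := by
    ext z; simp only [Finset.mem_Ioo, Finset.mem_insert, Finset.mem_Ico]; omega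
  rw [wtZ, wtDiagZ, this, Finset.sum_insert (by simp)]
  simp

theorem wtZ_zero_neg_one (a : ZMat) : wtZ m 0 a (-1) = wtDiagZ m a + 1 := by
  have : Finset.Ico (0 : ℤ) (m : ℤ) = Finset.Ioo (-1) (m : ℤ) := by
    ext z; simp only [Finset.mem_Ioo, Finset.mem_Ico]; omega
  rw [wtZ, wtDiagZ, this]
  simp

end Commutation

section Commutation

variable {m n d : ℕ}

/-- The left operator `B_j` in integer labels. -/
def LZ (m n d : ℕ) (j : ℤ) : Module.End K (VZ m n d) := trAlg n m d (RZ n m d j)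

theorem LZ_tZ (j : ℤ) {a : ZMat} (h : IsXi m n d a) :
    LZ m n d j (tZ m n d a) = ∑ o ∈ idxZ n, coefZ n j o (trMat a) •
      tZ m n d (a + trMat (stepZ j o)) := by
  rw [LZ, trAlg_apply, trZ_tZ, RZ_tZ j h.transpose, map_sum]
  refine Finset.sum_congr rfl fun o _ => ?_
  rw [map_smul, trZ_tZ]
  rfl

theorem IsXi.add_trMat_stepZ {a : ZMat} (h : IsXi m n d a) {j : ℤ} (hj : (-m : ℤ) < j)
    (hj' : j < m) {o : Option ℤ} (ho : coefZ n j o (trMat a) ≠ 0) :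
    IsXi m n d (a + trMat (stepZ j o)) :=
  (h.transpose.add_stepZ hj hj' ho).transpose

theorem RZ_LZ_tZ (i : ℤ) {j : ℤ} (hj : (-m : ℤ) < j) (hj' : j < m) {a : ZMat}
    (h : IsXi m n d a) :
    RZ m n d i (LZ m n d j (tZ m n d a)) = ∑ o ∈ idxZ m, ∑ o' ∈ idxZ n,
      (coefZ n j o' (trMat a) * coefZ m i o (a + trMat (stepZ j o'))) •
        tZ m n d (a + trMat (stepZ j o') + stepZ i o) := by
  rw [LZ_tZ j h, map_sum, Finset.sum_comm]
  refine Finset.sum_congr rfl fun o _ => ?_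
  rw [map_smul]
  by_cases ho : coefZ n j o (trMat a) = 0
  · simp [ho]
  · rw [RZ_tZ i (h.add_trMat_stepZ hj hj' ho), Finset.smul_sum]
    simp only [smul_smul]

theorem LZ_RZ_tZ {i : ℤ} (hi : (-n : ℤ) < i) (hi' : i < n) (j : ℤ) {a : ZMat}
    (h : IsXi m n d a) :
    LZ m n d j (RZ m n d i (tZ m n d a)) = ∑ o ∈ idxZ m, ∑ o' ∈ idxZ n,
      (coefZ m i o a * coefZ n j o' (trMat (a + stepZ i o))) •
        tZ m n d (a + trMat (stepZ j o') + stepZ i o) := by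
  rw [RZ_tZ i h, map_sum]
  refine Finset.sum_congr rfl fun o _ => ?_
  rw [map_smul]
  by_cases ho : coefZ m i o a = 0
  · simp [ho]
  · rw [LZ_tZ j (h.add_stepZ hi hi' ho), Finset.smul_sum]
    simp only [smul_smul, add_right_comm]

/-- The coefficients of the commutator of `RZ i` and `LZ j`. -/
def commCoef (m n : ℕ) (i j : ℤ) (a : ZMat) (o o' : Option ℤ) : K :=
  coefZ n j o' (trMat a) * coefZ m i o (a + trMat (stepZ j o')) -
    coefZ m i o a * coefZ n j o' (trMat (a + stepZ i o))

/-- The change of an entry under a column move. -/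
def bumpZ (i j x y : ℤ) : ℤ :=
  ((if i = y ∧ x = j - 1 then 1 else 0) + (if i = -1 - y ∧ x = -1 - (j - 1) then 1 else 0)) -
    ((if i = y ∧ x = j then 1 else 0) + (if i = -1 - y ∧ x = -1 - j then 1 else 0))

theorem commCoef_some_some {i j : ℤ} (hi : (-n : ℤ) < i) (hi' : i < n) (hj : (-m : ℤ) < j)
    (hj' : j < m) (a : ZMat) (x y : ℤ) :
    commCoef m n i j a (some x) (some y) = q ^ (wtZ m i a x + wtZ n j (trMat a) y) *
      (q ^ shiftZ i j x y * qint (a j y) * qint (a x i + bumpZ i j x y) -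
        q ^ shiftZ j i y x * qint (a x i) * qint (a j y + bumpZ j i y x)) := by
  have h0 := q_ne_zero
  simp only [commCoef, coefZ, stepZ]
  rw [wtZ_add_trMat_moveZ i hj hj', trMat_add, wtZ_add_trMat_moveZ j hi hi', zpow_add₀ h0,
    zpow_add₀ h0, zpow_add₀ h0]
  change _ * qint (a j y) * (_ * qint (a x i + bumpZ i j x y)) -
    _ * qint (a x i) * (_ * qint (a j y + bumpZ j i y x)) = _
  ring

theorem commCoef_generic {i j : ℤ} (hi : (-n : ℤ) < i) (hi' : i < n) (hj : (-m : ℤ) < j)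
    (hj' : j < m) {a : ZMat} (ha : IsXi m n d a) {x y : ℤ}
    (h1 : ¬ (x = j - 1 ∧ y = i)) (h2 : ¬ (x = j ∧ y = i - 1))
    (h3 : ¬ (x = -j ∧ y = -1 - i)) (h4 : ¬ (x = -1 - j ∧ y = -i)) :
    commCoef m n i j a (some x) (some y) = 0 := by
  have hs : shiftZ i j x y = shiftZ j i y x := by
    unfold shiftZ
    by_cases e1 : x = j - 1
    · split_ifs <;> omega
    by_cases e2 : x = -1 - j
    · split_ifs <;> omega
    simp only [e1, e2, if_false]
    split_ifs <;> omega
  have hb : bumpZ i j x y = bumpZ j i y x := by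
    unfold bumpZ
    split_ifs <;> omega
  have hb' : bumpZ j i y x = 0 ∨ (x = j ∧ y = i) ∨ (x = -1 - j ∧ y = -1 - i) := by
    unfold bumpZ
    split_ifs <;> omega
  rw [commCoef_some_some hi hi' hj hj', hs, hb]
  rcases hb' with e | ⟨rfl, rfl⟩ | ⟨rfl, rfl⟩
  · rw [e, add_zero, add_zero]; ring
  · ring
  · have : a (-1 - j) i = a j (-1 - i) := by rw [ha.symm]; congr 1; ring
    rw [this]
    ring

theorem sub_one_qint (c : ℤ) : q⁻¹ * qint (c + 1) - qint c = q ^ (-c - 1) := by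
  have h0 := q_ne_zero
  rw [qint_succ, sub_eq_add_neg (-c), zpow_add₀ h0, zpow_neg_one]
  field_simp
  ring

theorem commCoef_swap {i j : ℤ} (hi : (-n : ℤ) < i) (hi' : i < n) (hj : (-m : ℤ) < j)
    (hj' : j < m) (hij : ¬ (i = 0 ∧ j = 0)) (a : ZMat) :
    commCoef m n i j a (some j) (some (i - 1)) =
      - commCoef m n i j a (some (j - 1)) (some i) := by
  have h0 := q_ne_zero
  rw [commCoef_some_some hi hi' hj hj', commCoef_some_some hi hi' hj hj']
  have e1 : shiftZ i j j (i - 1) = 0 := by unfold shiftZ; split_ifs <;> omega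
  have e2 : shiftZ j i (i - 1) j = -1 := by unfold shiftZ; split_ifs <;> omega
  have e3 : bumpZ i j j (i - 1) = 0 := by unfold bumpZ; split_ifs <;> omega
  have e4 : bumpZ j i (i - 1) j = 1 := by unfold bumpZ; split_ifs <;> omega
  have e5 : shiftZ i j (j - 1) i = -1 := by unfold shiftZ; split_ifs <;> omega
  have e6 : shiftZ j i i (j - 1) = 0 := by unfold shiftZ; split_ifs <;> omega
  have e7 : bumpZ i j (j - 1) i = 1 := by unfold bumpZ; split_ifs <;> omega
  have e8 : bumpZ j i i (j - 1) = 0 := by unfold bumpZ; split_ifs <;> omega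
  rw [e1, e2, e3, e4, e5, e6, e7, e8, wtZ_sub_one i a hj', wtZ_sub_one j (trMat a) hi',
    if_neg (by omega), if_neg (by omega)]
  simp only [trMat, add_zero, zpow_zero, one_mul, zpow_neg_one]
  have k1 : q⁻¹ * qint (a j i) * qint (a j (i - 1) + 1) =
      qint (a j i) * (qint (a j (i - 1)) + q ^ (-a j (i - 1) - 1)) := by
    rw [← sub_one_qint]; ring
  have k2 : q⁻¹ * qint (a j i) * qint (a (j - 1) i + 1) =
      qint (a j i) * (qint (a (j - 1) i) + q ^ (-a (j - 1) i - 1)) := by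
    rw [← sub_one_qint]; ring
  rw [k1, k2]
  rw [mul_comm (qint (a j (i - 1))), mul_comm (qint (a (j - 1) i))]
  rw [mul_add, mul_add, sub_add_cancel_left, add_sub_cancel_left, mul_neg, mul_left_comm,
    mul_left_comm (q ^ _) (qint _) (q ^ _), ← zpow_add₀ h0, ← zpow_add₀ h0]
  congr 3
  ring

theorem commCoef_swap' {i j : ℤ} (hi : (-n : ℤ) < i) (hi' : i < n) (hj : (-m : ℤ) < j)
    (hj' : j < m) (hij : ¬ (i = 0 ∧ j = 0)) {a : ZMat} (ha : IsXi m n d a) :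
    commCoef m n i j a (some (-1 - j)) (some (-i)) =
      - commCoef m n i j a (some (-j)) (some (-1 - i)) := by
  have h0 := q_ne_zero
  rw [commCoef_some_some hi hi' hj hj', commCoef_some_some hi hi' hj hj']
  have e1 : shiftZ i j (-1 - j) (-i) = -1 := by unfold shiftZ; split_ifs <;> omega
  have e2 : shiftZ j i (-i) (-1 - j) = 0 := by unfold shiftZ; split_ifs <;> omega
  have e3 : bumpZ i j (-1 - j) (-i) = 0 := by unfold bumpZ; split_ifs <;> omega
  have e4 : bumpZ j i (-i) (-1 - j) = 1 := by unfold bumpZ; split_ifs <;> omega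
  have e5 : shiftZ i j (-j) (-1 - i) = 0 := by unfold shiftZ; split_ifs <;> omega
  have e6 : shiftZ j i (-1 - i) (-j) = -1 := by unfold shiftZ; split_ifs <;> omega
  have e7 : bumpZ i j (-j) (-1 - i) = 1 := by unfold bumpZ; split_ifs <;> omega
  have e8 : bumpZ j i (-1 - i) (-j) = 0 := by unfold bumpZ; split_ifs <;> omega
  have w1 := wtZ_sub_one i a (m := m) (x := -j) (by omega)
  have w2 := wtZ_sub_one j (trMat a) (m := n) (x := -i) (by omega)
  rw [if_neg (by omega)] at w1 w2
  rw [show -j - 1 = -1 - j by ring] at w1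
  rw [show -i - 1 = -1 - i by ring] at w2
  rw [e1, e2, e3, e4, e5, e6, e7, e8, w1, w2]
  have s1 : a (-1 - j) i = a j (-1 - i) := by rw [ha.symm]; congr 1; ring
  have s2 : a (j - 1) (-i) = a (-j) (i - 1) := by
    rw [ha.symm, show -1 - (j - 1) = -j by ring, show -1 - -i = i - 1 by ring]
  simp only [trMat, add_zero, zpow_zero, one_mul, zpow_neg_one, s1, s2]
  rw [qint_succ', qint_succ']
  rw [show ∀ X Y Z : K, q⁻¹ * X * Y - Y * (q⁻¹ * X + Z) = -(Z * Y) by intros; ring,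
    show ∀ X Y Z : K, X * (q⁻¹ * Y + Z) - q⁻¹ * Y * X = Z * X by intros; ring, mul_neg,
    ← mul_assoc, ← mul_assoc, ← zpow_add₀ h0, ← zpow_add₀ h0]
  congr 3
  have s3 : a (-j) i = a (j - 1) (-1 - i) := by rw [ha.symm]; congr 1; ring
  rw [s3]
  ring

theorem commCoef_zero_swap (hm : 1 ≤ m) (hn : 1 ≤ n) {a : ZMat} (ha : IsXi m n d a) :
    commCoef m n 0 0 a (some 0) (some (-1)) =
      - commCoef m n 0 0 a (some (-1)) (some 0) := by
  rw [commCoef_some_some (by omega) (by omega) (by omega) (by omega),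
    commCoef_some_some (by omega) (by omega) (by omega) (by omega)]
  have s1 : a (-1) 0 = a 0 (-1) := by rw [ha.symm]; rfl
  rw [wtZ_zero_zero hm, wtZ_zero_zero hn, wtZ_zero_neg_one, wtZ_zero_neg_one]
  simp [shiftZ, bumpZ, trMat, s1]
  ring_nf

theorem commCoef_zero_none {y : ℤ} (hm : 1 ≤ m) (hn : 1 ≤ n) {a : ZMat} (ha : IsXi m n d a)
    (hy : y = 0 ∨ y = -1) :
    commCoef m n 0 0 a (some y) none = - commCoef m n 0 0 a none (some y) := by
  have h0 := q_ne_zero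
  have s1 : a (-1) 0 = a 0 (-1) := by rw [ha.symm]; rfl
  simp only [commCoef, coefZ, stepZ, trMat_add, if_true]
  rw [wtDiagZ_add_trMat_moveZ (m := m) (by omega) (by omega),
    wtDiagZ_add_trMat_moveZ (m := n) (by omega) (by omega), show trMat 0 = 0 from rfl, add_zero,
    add_zero]
  rcases hy with rfl | rfl
  · rw [wtZ_zero_zero hm, wtZ_zero_zero hn]
    simp only [trMat, s1, zpow_add₀ h0, zpow_sub₀ h0]
    ring
  · rw [wtZ_zero_neg_one, wtZ_zero_neg_one]
    simp only [trMat, s1, zpow_add₀ h0]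
    ring

end Commutation

section Commutation

variable {m n d : ℕ}

theorem commCoef_none {i j : ℤ} (hij : ¬ (i = 0 ∧ j = 0)) (hi : (-n : ℤ) < i) (hi' : i < n)
    (hj : (-m : ℤ) < j) (hj' : j < m) (a : ZMat) (o : Option ℤ) :
    commCoef m n i j a none o = 0 ∧ commCoef m n i j a o none = 0 := by
  constructor
  · by_cases h : i = 0
    · have h' : j ≠ 0 := fun h' => hij ⟨h, h'⟩
      cases o with
      | none => simp [commCoef, coefZ, stepZ, h']
      | some y =>
        simp only [commCoef, coefZ, stepZ, add_zero, wtDiagZ_add_trMat_moveZ hj hj', if_neg h']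
        ring
    · simp [commCoef, coefZ, h]
  · by_cases h' : j = 0
    · have h : i ≠ 0 := fun h => hij ⟨h, h'⟩
      cases o with
      | none => simp [commCoef, coefZ, stepZ, h]
      | some y =>
        simp only [commCoef, coefZ, stepZ, show trMat 0 = 0 from rfl, trMat_add, add_zero,
          wtDiagZ_add_trMat_moveZ hi hi', if_neg h]
        ring
    · simp [commCoef, coefZ, h']

theorem commCoef_none_zero (hm : 1 ≤ m) (hn : 1 ≤ n) (a : ZMat) {y : ℤ}
    (hy : ¬ (y = 0 ∨ y = -1)) :
    commCoef m n 0 0 a none (some y) = 0 ∧ commCoef m n 0 0 a (some y) none = 0 := by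
  simp only [not_or] at hy
  constructor
  · simp only [commCoef, coefZ, stepZ, add_zero]
    rw [wtDiagZ_add_trMat_moveZ (by omega) (by omega), if_neg hy.1, if_neg hy.2]
    simp [mul_comm]
  · simp only [commCoef, coefZ, stepZ, show trMat 0 = 0 from rfl, trMat_add, add_zero]
    rw [wtDiagZ_add_trMat_moveZ (by omega) (by omega), if_neg hy.1, if_neg hy.2]
    simp [mul_comm]

theorem sum_sum_eq_single {M : Type*} [AddCommMonoid M] {s t : Finset ℤ} {r c : ℤ} (hr : r ∈ s)
    (hc : c ∈ t) (v : M) :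
    ∑ x ∈ s, ∑ y ∈ t, (if x = r ∧ y = c then v else 0) = v := by
  rw [Finset.sum_eq_single r, Finset.sum_eq_single c]
  · simp
  · intro b _ hb; simp [hb]
  · intro h; exact absurd hc h
  · intro b _ hb; simp [hb]
  · intro h; exact absurd hr h

theorem trMat_chiZ (r c : ℤ) : trMat (chiZ r c) = chiZ c r := by
  funext x y
  simp only [trMat, chiZ, and_comm]

theorem chiZ_neg (r c : ℤ) : chiZ (-1 - r) (-1 - c) = chiZ r c := by
  funext x y
  simp only [chiZ, sub_sub_cancel]
  rw [add_comm]

theorem trMat_moveZ (j y : ℤ) : trMat (moveZ j y) = chiZ (j - 1) y - chiZ j y := by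
  change trMat (chiZ y (j - 1)) - trMat (chiZ y j) = _
  rw [trMat_chiZ, trMat_chiZ]

theorem stepZ_swap (i j : ℤ) (a : ZMat) :
    a + trMat (moveZ j (i - 1)) + moveZ i j = a + trMat (moveZ j i) + moveZ i (j - 1) := by
  rw [trMat_moveZ, trMat_moveZ, moveZ, moveZ]
  abel

theorem stepZ_swap' (i j : ℤ) (a : ZMat) :
    a + trMat (moveZ j (-i)) + moveZ i (-1 - j) =
      a + trMat (moveZ j (-1 - i)) + moveZ i (-j) := by
  rw [trMat_moveZ, trMat_moveZ, moveZ, moveZ, ← chiZ_neg (-1 - j), ← chiZ_neg (-1 - j),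
    ← chiZ_neg (-j), ← chiZ_neg (-j), show -1 - (-1 - j) = j by ring,
    show -1 - (i - 1) = -i by ring, show -1 - -j = j - 1 by ring]
  abel

theorem moveZ_zero_swap {y : ℤ} (hy : y = 0 ∨ y = -1) : trMat (moveZ 0 y) = moveZ 0 y := by
  funext u v
  simp only [trMat, moveZ, Pi.sub_apply, chiZ]
  rcases hy with rfl | rfl <;> split_ifs <;> omega

theorem sum_commCoef_of_ne {i j : ℤ} (hi : (-n : ℤ) < i) (hi' : i < n) (hj : (-m : ℤ) < j)
    (hj' : j < m) (hij : ¬ (i = 0 ∧ j = 0)) {a : ZMat} (ha : IsXi m n d a) :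
    ∑ o ∈ idxZ m, ∑ o' ∈ idxZ n, commCoef m n i j a o o' •
      tZ m n d (a + trMat (stepZ j o') + stepZ i o) = 0 := by
  have hn : ∀ o, commCoef m n i j a none o = 0 := fun o =>
    (commCoef_none hij hi hi' hj hj' a o).1
  have hn' : ∀ o, commCoef m n i j a o none = 0 := fun o =>
    (commCoef_none hij hi hi' hj hj' a o).2
  simp only [idxZ, Finset.sum_insertNone, hn, hn', zero_smul, Finset.sum_const_zero, zero_add]
  set f : ℤ → ℤ → VZ m n d := fun x y => commCoef m n i j a (some x) (some y) •
      tZ m n d (a + trMat (stepZ j (some y)) + stepZ i (some x)) with hf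
  have f1 : f j (i - 1) = - f (j - 1) i := by
    simp only [hf, commCoef_swap hi hi' hj hj' hij, stepZ, stepZ_swap, neg_smul]
  have f2 : f (-1 - j) (-i) = - f (-j) (-1 - i) := by
    simp only [hf, commCoef_swap' hi hi' hj hj' hij ha, stepZ, stepZ_swap', neg_smul]
  have key : ∀ x y, f x y = (if x = j - 1 ∧ y = i then f (j - 1) i else 0) +
      (if x = j ∧ y = i - 1 then f j (i - 1) else 0) +
      ((if x = -j ∧ y = -1 - i then f (-j) (-1 - i) else 0) +
      (if x = -1 - j ∧ y = -i then f (-1 - j) (-i) else 0)) := by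
    intro x y
    by_cases h1 : x = j - 1 ∧ y = i
    · rw [if_pos h1, if_neg (by omega), if_neg (by omega), if_neg (by omega), h1.1, h1.2]
      simp only [add_zero]
    by_cases h2 : x = j ∧ y = i - 1
    · rw [if_pos h2, if_neg (by omega), if_neg (by omega), if_neg (by omega), h2.1, h2.2]
      simp only [add_zero, zero_add]
    by_cases h3 : x = -j ∧ y = -1 - i
    · rw [if_pos h3, if_neg (by omega), if_neg (by omega), if_neg (by omega), h3.1, h3.2]
      simp only [add_zero, zero_add]
    by_cases h4 : x = -1 - j ∧ y = -i
    · rw [if_pos h4, if_neg (by omega), if_neg (by omega), if_neg (by omega), h4.1, h4.2]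
      simp only [add_zero, zero_add]
    rw [if_neg h1, if_neg h2, if_neg h3, if_neg h4]
    simp only [hf, commCoef_generic hi hi' hj hj' ha h1 h2 h3 h4, zero_smul, add_zero]
  refine (Finset.sum_congr rfl fun x _ => Finset.sum_congr rfl fun y _ => key x y).trans ?_
  simp only [Finset.sum_add_distrib]
  rw [sum_sum_eq_single, sum_sum_eq_single, sum_sum_eq_single, sum_sum_eq_single, f1, f2]
  · abel
  all_goals rw [Finset.mem_Ico]; omega

theorem sum_commCoef_zero (hm : 1 ≤ m) (hn : 1 ≤ n) {a : ZMat} (ha : IsXi m n d a) :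
    ∑ o ∈ idxZ m, ∑ o' ∈ idxZ n, commCoef m n 0 0 a o o' •
      tZ m n d (a + trMat (stepZ 0 o') + stepZ 0 o) = 0 := by
  set f : Option ℤ → Option ℤ → VZ m n d := fun o o' => commCoef m n 0 0 a o o' •
      tZ m n d (a + trMat (stepZ 0 o') + stepZ 0 o) with hf
  have fn : f none none = 0 := by
    simp [hf, commCoef, coefZ, stepZ, show trMat 0 = 0 from rfl, mul_comm]
  have f1 : f (some 0) (some (-1)) = - f (some (-1)) (some 0) := by
    simp only [hf, commCoef_zero_swap hm hn ha, neg_smul]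
    have := stepZ_swap 0 0 a
    rw [zero_sub] at this
    rw [show a + trMat (stepZ 0 (some (-1))) + stepZ 0 (some 0) =
      a + trMat (stepZ 0 (some 0)) + stepZ 0 (some (-1)) from this]
  have f2 : ∀ y, f (some y) none = - f none (some y) := by
    intro y
    by_cases hy : y = 0 ∨ y = -1
    · simp only [hf, commCoef_zero_none hm hn ha hy, stepZ, moveZ_zero_swap hy, neg_smul,
        show trMat 0 = 0 from rfl, add_zero]
    · simp only [hf, commCoef_none_zero hm hn a hy, zero_smul, neg_zero]
  have f3 : ∀ y, ¬ (y = 0 ∨ y = -1) → f none (some y) = 0 := by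
    intro y hy
    simp only [hf, commCoef_none_zero hm hn a hy, zero_smul]
  have key : ∀ x y, f (some x) (some y) =
      (if x = -1 ∧ y = 0 then f (some (-1)) (some 0) else 0) +
      (if x = 0 ∧ y = -1 then f (some 0) (some (-1)) else 0) := by
    intro x y
    by_cases h1 : x = -1 ∧ y = 0
    · obtain ⟨rfl, rfl⟩ := h1
      simp
    by_cases h2 : x = 0 ∧ y = -1
    · obtain ⟨rfl, rfl⟩ := h2
      simp
    rw [if_neg h1, if_neg h2]
    simp only [hf]
    rw [commCoef_generic (by omega) (by omega) (by omega) (by omega) ha (by omega) (by omega)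
      (by omega) (by omega), zero_smul, add_zero]
  have key2 : ∀ N : ℕ, 1 ≤ N → ∑ y ∈ Finset.Ico (-N : ℤ) N, f none (some y) =
      f none (some (-1)) + f none (some 0) := by
    intro N hN
    rw [← Finset.sum_pair (f := fun y => f none (some y)) (by norm_num : (-1 : ℤ) ≠ 0)]
    symm
    apply Finset.sum_subset
    · intro y hy
      simp only [Finset.mem_insert, Finset.mem_singleton] at hy
      rw [Finset.mem_Ico]
      omega
    · intro y _ hy
      simp only [Finset.mem_insert, Finset.mem_singleton] at hy
      exact f3 y (by omega)
  change ∑ o ∈ idxZ m, ∑ o' ∈ idxZ n, f o o' = 0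
  have key3 : ∑ x ∈ Finset.Ico (-m : ℤ) m, ∑ y ∈ Finset.Ico (-n : ℤ) n, f (some x) (some y) =
      f (some (-1)) (some 0) + f (some 0) (some (-1)) := by
    refine (Finset.sum_congr rfl fun x _ => Finset.sum_congr rfl fun y _ => key x y).trans ?_
    simp only [Finset.sum_add_distrib]
    rw [sum_sum_eq_single, sum_sum_eq_single]
    all_goals rw [Finset.mem_Ico]; omega
  simp only [idxZ, Finset.sum_insertNone, Finset.sum_add_distrib]
  rw [key3, key2 n hn, fn, f1]
  simp only [f2, Finset.sum_neg_distrib]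
  rw [key2 m hm]
  abel

theorem RZ_comm_LZ {i j : ℤ} (hi : (-n : ℤ) < i) (hi' : i < n) (hj : (-m : ℤ) < j)
    (hj' : j < m) : RZ m n d i * LZ m n d j = LZ m n d j * RZ m n d i := by
  refine linearMap_ext_tZ fun a ha => ?_
  rw [Module.End.mul_apply, Module.End.mul_apply, RZ_LZ_tZ i hj hj' ha, LZ_RZ_tZ hi hi' j ha,
    ← sub_eq_zero, ← Finset.sum_sub_distrib]
  simp only [← Finset.sum_sub_distrib, ← sub_smul]
  by_cases hij : i = 0 ∧ j = 0
  · obtain ⟨rfl, rfl⟩ := hij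
    exact sum_commCoef_zero (by omega) (by omega) ha
  · exact sum_commCoef_of_ne hi hi' hj hj' hij ha

end Commutation

section Cartan

variable {m n d : ℕ}

theorem colZ_add_trMat_stepZ {j : ℤ} (hj : (-m : ℤ) < j) (hj' : j < m) (a : ZMat)
    (o : Option ℤ) (r : ℤ) : colZ m (a + trMat (stepZ j o)) r = colZ m a r := by
  cases o with
  | none => rw [stepZ, show trMat 0 = 0 from rfl, add_zero]
  | some y =>
    have : ∀ z c, (a + trMat (moveZ j y)) z c = a z c +
        (((if c = y ∧ z = j - 1 then 1 else 0) +
          (if c = -1 - y ∧ z = -1 - (j - 1) then 1 else 0)) -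
        ((if c = y ∧ z = j then 1 else 0) + (if c = -1 - y ∧ z = -1 - j then 1 else 0))) :=
      fun z c => rfl
    simp only [colZ, stepZ, this, Finset.sum_sub_distrib, Finset.sum_add_distrib,
      sum_ite_and_eq, Finset.mem_Ico]
    split_ifs <;> omega

theorem diagZ_comm_LZ {j : ℤ} (hj : (-m : ℤ) < j) (hj' : j < m) {g : ZMat → K}
    (hg : ∀ a o, g (a + trMat (stepZ j o)) = g a) :
    diagZ m n d g * LZ m n d j = LZ m n d j * diagZ m n d g := by
  refine linearMap_ext_tZ fun a ha => ?_
  rw [Module.End.mul_apply, Module.End.mul_apply, diagZ_tZ g ha, map_smul, LZ_tZ j ha, map_sum,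
    Finset.smul_sum]
  refine Finset.sum_congr rfl fun o _ => ?_
  rw [map_smul, smul_comm]
  by_cases ho : coefZ n j o (trMat a) = 0
  · simp [ho]
  · rw [diagZ_tZ g (ha.add_trMat_stepZ hj hj' ho), hg]

theorem diagZ_mul (g h : ZMat → K) :
    diagZ m n d g * diagZ m n d h = diagZ m n d fun a => g a * h a := by
  refine linearMap_ext_tZ fun a ha => ?_
  rw [Module.End.mul_apply, diagZ_tZ h ha, map_smul, diagZ_tZ g ha, diagZ_tZ _ ha, smul_smul,
    mul_comm]

theorem trAlg_diagZ (g : ZMat → K) :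
    trAlg m n d (diagZ m n d g) = diagZ n m d fun a => g (trMat a) := by
  refine linearMap_ext_tZ fun a ha => ?_
  rw [trAlg_apply, trZ_tZ, diagZ_tZ g ha.transpose, map_smul, trZ_tZ, diagZ_tZ _ ha]
  rfl

theorem trAlg_LZ (i : ℤ) : trAlg m n d (LZ m n d i) = RZ n m d i := trAlg_trAlg _

theorem CZ_comm_LZ {j : ℤ} (hj : (-m : ℤ) < j) (hj' : j < m) (r e : ℤ) :
    CZ m n d r e * LZ m n d j = LZ m n d j * CZ m n d r e :=
  diagZ_comm_LZ hj hj' fun a o => by rw [colZ_add_trMat_stepZ hj hj']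

theorem commute_of_mem_gensZ {A : Module.End K (VZ m n d)} {B : Module.End K (VZ n m d)}
    (hA : A ∈ gensZ m n d) (hB : B ∈ gensZ n m d) : Commute A (trAlg n m d B) := by
  have hCC : ∀ r e s f, Commute (CZ m n d r e) (trAlg n m d (CZ n m d s f)) := by
    intro r e s f
    rw [CZ, CZ, trAlg_diagZ, Commute, SemiconjBy, diagZ_mul, diagZ_mul]
    simp only [mul_comm]
  have hCR : ∀ r e (i : ℤ), (-n : ℤ) < i → i < n → Commute (RZ m n d i) (trAlg n m d (CZ n m d r e)) := by
    intro r e i hi hi'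
    have h := congrArg (trAlg n m d) (CZ_comm_LZ (m := n) (n := m) (d := d) hi hi' r e)
    rw [map_mul, map_mul, trAlg_LZ] at h
    exact h.symm
  rcases hA with ⟨i, hi, hi', rfl⟩ | ⟨r, -, -, hr⟩
  · rcases hB with ⟨j, hj, hj', rfl⟩ | ⟨s, -, -, rfl | rfl⟩
    · exact RZ_comm_LZ hi hi' hj hj'
    · exact hCR _ _ _ hi hi'
    · exact hCR _ _ _ hi hi'
  · rcases hB with ⟨j, hj, hj', rfl⟩ | ⟨s, -, -, rfl | rfl⟩
    · rcases hr with rfl | rfl <;> exact CZ_comm_LZ hj hj' _ _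
    · rcases hr with rfl | rfl <;> exact hCC _ _ _ _
    · rcases hr with rfl | rfl <;> exact hCC _ _ _ _

/-- The algebra generated by the right operators. -/
def algR (m n d : ℕ) : Subalgebra K (Module.End K (VZ m n d)) := Algebra.adjoin K (gensZ m n d)

/-- The algebra generated by the left operators. -/
def algL (m n d : ℕ) : Subalgebra K (Module.End K (VZ m n d)) :=
  (algR n m d).map (trAlg n m d : Module.End K (VZ n m d) →ₐ[K] Module.End K (VZ m n d))

theorem mem_algL {f : Module.End K (VZ m n d)} : f ∈ algL m n d ↔ trAlg m n d f ∈ algR n m d := by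
  constructor
  · rintro ⟨g, hg, rfl⟩
    change trAlg m n d (trAlg n m d g) ∈ _
    rwa [trAlg_trAlg]
  · intro h
    exact ⟨_, h, trAlg_trAlg f⟩

theorem algL_eq_adjoin : algL m n d = Algebra.adjoin K (trAlg n m d '' gensZ n m d) :=
  AlgHom.map_adjoin _ _

theorem commute_of_mem_algR_algL {A B : Module.End K (VZ m n d)} (hA : A ∈ algR m n d)
    (hB : B ∈ algL m n d) : Commute A B := by
  rw [algL_eq_adjoin] at hB
  refine Algebra.commute_of_mem_adjoin_of_forall_mem_commute hB ?_
  rintro _ ⟨b, hb, rfl⟩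
  exact (Algebra.commute_of_mem_adjoin_of_forall_mem_commute hA fun a ha =>
    (commute_of_mem_gensZ ha hb).symm).symm

theorem mem_Ico_neg {N : ℕ} {r : ℤ} : -1 - r ∈ Finset.Ico (-N : ℤ) N ↔ r ∈ Finset.Ico (-N : ℤ) N := by
  rw [Finset.mem_Ico, Finset.mem_Ico]; omega

theorem sum_Ico_neg {M : Type*} [AddCommMonoid M] (N : ℕ) (f : ℤ → M) :
    ∑ x ∈ Finset.Ico (-N : ℤ) N, f (-1 - x) = ∑ x ∈ Finset.Ico (-N : ℤ) N, f x :=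
  Finset.sum_nbij' (fun x => -1 - x) (fun x => -1 - x) (fun x hx => mem_Ico_neg.2 hx)
    (fun x hx => mem_Ico_neg.2 hx) (by simp) (by simp) (by simp)

theorem IsXi.colZ_neg {a : ZMat} (h : IsXi m n d a) (r : ℤ) : colZ m a (-1 - r) = colZ m a r := by
  rw [colZ, colZ, ← sum_Ico_neg]
  refine Finset.sum_congr rfl fun x _ => ?_
  rw [← h.symm]

theorem CZ_neg (r e : ℤ) : CZ m n d (-1 - r) e = CZ m n d r e := by
  refine linearMap_ext_tZ fun a ha => ?_
  rw [CZ, CZ, diagZ_tZ _ ha, diagZ_tZ _ ha, ha.colZ_neg]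

theorem CZ_mem_algR {r e : ℤ} (hr : (-n : ℤ) ≤ r) (hr' : r < n) (he : e = 1 ∨ e = -1) :
    CZ m n d r e ∈ algR m n d := by
  apply Algebra.subset_adjoin
  right
  by_cases h : 0 ≤ r
  · exact ⟨r, h, hr', by rcases he with rfl | rfl <;> simp⟩
  · exact ⟨-1 - r, by omega, by omega, by rw [CZ_neg, CZ_neg]; rcases he with rfl | rfl <;> simp⟩

theorem RZ_mem_algR {i : ℤ} (hi : (-n : ℤ) < i) (hi' : i < n) : RZ m n d i ∈ algR m n d :=
  Algebra.subset_adjoin (Or.inl ⟨i, hi, hi', rfl⟩)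

theorem IsXi.le_total {a : ZMat} (h : IsXi m n d a) (x y : ℤ) : a x y ≤ 2 * d := by
  by_cases h0 : a x y = 0
  · omega
  have hs := h.supp x y h0
  rw [← h.total]
  refine le_trans ?_ (Finset.single_le_sum (f := fun x => ∑ y ∈ Finset.Ico (-n : ℤ) n, a x y)
    (fun z _ => Finset.sum_nonneg fun w _ => h.nonneg z w) (Finset.mem_Ico.2 hs.1))
  exact Finset.single_le_sum (f := fun y => a x y) (fun w _ => h.nonneg x w)
    (Finset.mem_Ico.2 hs.2)

instance : Finite (XiZ m n d) := by
  let f : XiZ m n d → (Finset.Ico (-m : ℤ) m → Finset.Ico (-n : ℤ) n → Finset.Icc (0 : ℤ) (2 * d)) :=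
    fun a x y => ⟨a.1 x y, Finset.mem_Icc.2 ⟨a.2.nonneg _ _, a.2.le_total _ _⟩⟩
  refine Finite.of_injective f fun a b hab => Subtype.ext (funext fun x => funext fun y => ?_)
  by_cases h : x ∈ Finset.Ico (-m : ℤ) m ∧ y ∈ Finset.Ico (-n : ℤ) n
  · exact congrArg Subtype.val (congrFun (congrFun hab ⟨x, h.1⟩) ⟨y, h.2⟩)
  · simp only [Finset.mem_Ico] at h
    rw [not_imp_comm.1 (a.2.supp x y) h, not_imp_comm.1 (b.2.supp x y) h]

end Cartan

section Adjoint

variable {m n d : ℕ}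

/-- The factor of a matrix entry in the squared norm of a basis vector. -/
def entryNorm : ℕ → K
  | 0 => 1
  | k + 1 => entryNorm k * (q ^ (-(k : ℤ)) * qint (k + 1))

/-- The squared norm of the basis vector indexed by `a`. -/
def normZ (m n : ℕ) (a : ZMat) : K :=
  ∏ x ∈ Finset.Ico (0 : ℤ) m, ∏ y ∈ Finset.Ico (-n : ℤ) n, entryNorm (a x y).toNat

/-- The symmetric form for which the basis is orthogonal with squared norms `normZ`. -/
def formZ (m n d : ℕ) : LinearMap.BilinForm K (VZ m n d) :=
  Finsupp.lift (VZ m n d →ₗ[K] K) K (XiZ m n d) fun a => normZ m n a.1 • Finsupp.lapply a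

theorem formZ_tZ_left {a : ZMat} (ha : IsXi m n d a) (v : VZ m n d) :
    formZ m n d (tZ m n d a) v = normZ m n a * v ⟨a, ha⟩ := by
  simp [formZ, tZ_of_isXi ha]

theorem tZ_apply {a b : ZMat} (hb : IsXi m n d b) :
    tZ m n d a ⟨b, hb⟩ = if a = b then 1 else 0 := by
  by_cases h : a = b
  · subst h
    simp [tZ_of_isXi hb]
  · rw [if_neg h, tZ]
    split_ifs with ha
    · rw [Finsupp.single_apply, if_neg fun e => h (congrArg Subtype.val e)]
    · rfl

theorem formZ_tZ_tZ {a b : ZMat} (ha : IsXi m n d a) :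
    formZ m n d (tZ m n d a) (tZ m n d b) = if a = b then normZ m n a else 0 := by
  rw [formZ_tZ_left ha, tZ_apply]
  by_cases h : a = b
  · simp [h]
  · simp [h, Ne.symm h]

theorem formZ_tZ_tZ_right {a b : ZMat} (hb : IsXi m n d b) :
    formZ m n d (tZ m n d a) (tZ m n d b) = if a = b then normZ m n b else 0 := by
  by_cases ha : IsXi m n d a
  · rw [formZ_tZ_tZ ha]
    split_ifs with h
    · rw [h]
    · rfl
  · have hne : a ≠ b := by
      rintro rfl
      exact ha hb
    rw [if_neg hne, tZ, dif_neg ha]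
    simp

theorem formZ_symm (u v : VZ m n d) : formZ m n d u v = formZ m n d v u := by
  have : formZ m n d = (formZ m n d).flip := by
    refine linearMap_ext_tZ fun a ha => linearMap_ext_tZ fun b hb => ?_
    change _ = formZ m n d (tZ m n d b) (tZ m n d a)
    rw [formZ_tZ_tZ ha, formZ_tZ_tZ_right ha]
    simp only [eq_comm]
  exact congrArg (fun f => f u v) this

theorem formZ_apply (u v : VZ m n d) :
    formZ m n d u v = u.sum fun a c => c * (normZ m n a.1 * v a) := by
  simp [formZ, Finsupp.sum]

theorem ringHom_entryNorm_pos (φ : K →+* ℝ) (hφ : 1 < φ q) (k : ℕ) : 0 < φ (entryNorm k) := by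
  induction k with
  | zero => simp [entryNorm]
  | succ k ih =>
    have h0 : 0 < φ q := by linarith
    rw [entryNorm, qint]
    simp only [map_mul, map_div₀, map_sub, map_zpow₀, map_inv₀]
    refine mul_pos ih (mul_pos (zpow_pos h0 _) (div_pos ?_ ?_))
    · rw [sub_pos]
      exact zpow_lt_zpow_right₀ hφ (by omega)
    · rw [sub_pos]
      exact lt_trans (inv_lt_one_of_one_lt₀ hφ) hφ

theorem formZ_self_eq_zero {v : VZ m n d} (h : formZ m n d v v = 0) : v = 0 := by
  obtain ⟨φ, hφ⟩ := exists_ringHom_real_pos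
  have h' := congrArg φ h
  rw [formZ_apply, map_zero, Finsupp.sum, map_sum] at h'
  have hpos : ∀ a, 0 < φ (normZ m n a) := fun a => by
    simp only [normZ, map_prod]
    exact Finset.prod_pos fun _ _ => Finset.prod_pos fun _ _ => ringHom_entryNorm_pos φ hφ _
  rw [Finset.sum_eq_zero_iff_of_nonneg] at h'
  · ext a
    by_contra hv
    have h1 := h' a (Finsupp.mem_support_iff.2 hv)
    simp only [map_mul, mul_eq_zero, (hpos a.1).ne', false_or, or_self, map_eq_zero] at h1
    exact hv h1
  · intro a _
    simp only [map_mul]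
    have h1 : φ (v a) * (φ (normZ m n a.1) * φ (v a)) = φ (normZ m n a.1) * φ (v a) ^ 2 := by ring
    rw [h1]
    exact mul_nonneg (hpos _).le (sq_nonneg _)

/-- The scaling relating the `i`-th operator to its adjoint. -/
def adjScale (m : ℕ) (i : ℤ) (b : ZMat) : K :=
  if i = 0 then 1 else q ^ (1 - (colZ m b (i - 1) - colZ m b i))

theorem colZ_split (b : ZMat) (r : ℤ) {x : ℤ} (hx : (-m : ℤ) ≤ x) (hx' : x < m) :
    colZ m b r = ∑ z ∈ Finset.Ico (-m : ℤ) x, b z r + b x r + ∑ z ∈ Finset.Ioo x (m : ℤ), b z r := by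
  have h1 : Finset.Ico (-m : ℤ) m = Finset.Ico (-m : ℤ) x ∪ insert x (Finset.Ioo x (m : ℤ)) := by
    ext z; simp only [Finset.mem_Ioo, Finset.mem_insert, Finset.mem_Ico, Finset.mem_union]; omega
  rw [colZ, h1, Finset.sum_union, Finset.sum_insert (by simp), add_assoc]
  rw [Finset.disjoint_left]
  intro z
  simp only [Finset.mem_Ioo, Finset.mem_insert, Finset.mem_Ico]
  omega

theorem IsXi.sum_Ioo_neg {b : ZMat} (hb : IsXi m n d b) (r x : ℤ) :
    ∑ z ∈ Finset.Ioo (-1 - x) (m : ℤ), b z (-1 - r) = ∑ z ∈ Finset.Ico (-m : ℤ) x, b z r := by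
  refine Finset.sum_nbij' (fun x => -1 - x) (fun x => -1 - x) ?_ ?_ (by simp) (by simp) ?_
  · intro z hz; simp only [Finset.mem_Ioo, Finset.mem_Ico] at *; omega
  · intro z hz; simp only [Finset.mem_Ioo, Finset.mem_Ico] at *; omega
  · intro z _
    rw [hb.symm, sub_sub_cancel]

theorem IsXi.wtZ_neg {b : ZMat} (hb : IsXi m n d b) (i : ℤ) {x : ℤ} (hx : (-m : ℤ) ≤ x)
    (hx' : x < m) :
    wtZ m (-i) b (-1 - x) = colZ m b (i - 1) - colZ m b i + (b x i - b x (i - 1)) +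
      ∑ z ∈ Finset.Ioo x (m : ℤ), (b z i - b z (i - 1)) + if i = 0 ∧ 0 ≤ x then 1 else 0 := by
  have h1 := hb.sum_Ioo_neg (i - 1) x
  have h2 := hb.sum_Ioo_neg i x
  rw [show -1 - (i - 1) = -i by ring] at h1
  rw [show -1 - i = -i - 1 by ring] at h2
  rw [wtZ, Finset.sum_sub_distrib, Finset.sum_sub_distrib, h1, h2, colZ_split b i hx hx',
    colZ_split b (i - 1) hx hx']
  split_ifs <;> omega

theorem sum_Ioo_add_moveZ (i : ℤ) (a : ZMat) {x : ℤ} (hx : (-m : ℤ) ≤ x) :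
    ∑ z ∈ Finset.Ioo x (m : ℤ), ((a + moveZ i x) z i - (a + moveZ i x) z (i - 1)) =
      ∑ z ∈ Finset.Ioo x (m : ℤ), (a z i - a z (i - 1)) + if i = 0 ∧ x < 0 then 2 else 0 := by
  have h1 : ∀ z ∈ Finset.Ioo x (m : ℤ), (a + moveZ i x) z i - (a + moveZ i x) z (i - 1) =
      a z i - a z (i - 1) + if i = 0 ∧ z = -1 - x then 2 else 0 := by
    intro z hz
    rw [Finset.mem_Ioo] at hz
    simp only [Pi.add_apply, moveZ, Pi.sub_apply, chiZ]
    split_ifs <;> omega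
  rw [Finset.sum_congr rfl h1, Finset.sum_add_distrib]
  congr 1
  by_cases hi : i = 0
  · simp only [hi, true_and, Finset.sum_ite_eq', Finset.mem_Ioo]
    split_ifs <;> omega
  · simp [hi]

theorem prod_prod_eq_of_two {s t : Finset ℤ} {f g : ℤ → ℤ → K} {x y y' : ℤ} (hx : x ∈ s)
    (hy : y ∈ t) (hy' : y' ∈ t) (hne : y ≠ y') {A B : K}
    (h : f x y * f x y' * A = g x y * g x y' * B)
    (hfg : ∀ u v, ¬ (u = x ∧ (v = y ∨ v = y')) → u ∈ s → f u v = g u v) :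
    (∏ u ∈ s, ∏ v ∈ t, f u v) * A = (∏ u ∈ s, ∏ v ∈ t, g u v) * B := by
  rw [← Finset.mul_prod_erase s _ hx, ← Finset.mul_prod_erase s _ hx,
    ← Finset.mul_prod_erase t _ hy, ← Finset.mul_prod_erase t _ hy,
    ← Finset.mul_prod_erase (t.erase y) _ (Finset.mem_erase.2 ⟨hne.symm, hy'⟩),
    ← Finset.mul_prod_erase (t.erase y) _ (Finset.mem_erase.2 ⟨hne.symm, hy'⟩)]
  have h1 : ∏ v ∈ (t.erase y).erase y', f x v = ∏ v ∈ (t.erase y).erase y', g x v :=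
    Finset.prod_congr rfl fun v hv => hfg x v (by
      simp only [Finset.mem_erase] at hv
      tauto) hx
  have h2 : ∏ u ∈ s.erase x, ∏ v ∈ t, f u v = ∏ u ∈ s.erase x, ∏ v ∈ t, g u v :=
    Finset.prod_congr rfl fun u hu => Finset.prod_congr rfl fun v _ => hfg u v (fun h' =>
      (Finset.mem_erase.1 hu).1 h'.1) (Finset.mem_erase.1 hu).2
  rw [h1, h2]
  linear_combination (∏ v ∈ (t.erase y).erase y', g x v) *
    (∏ u ∈ s.erase x, ∏ v ∈ t, g u v) * h

theorem entryNorm_move {α β : ℤ} (hα : 0 < α) (hβ : 0 ≤ β) :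
    entryNorm (β + 1).toNat * entryNorm (α - 1).toNat * (q ^ β * qint α) =
      entryNorm β.toNat * entryNorm α.toNat * (q ^ (α - 1) * qint (β + 1)) := by
  have h0 := q_ne_zero
  lift β to ℕ using hβ
  obtain ⟨k, rfl⟩ : ∃ k : ℕ, α = k + 1 := ⟨(α - 1).toNat, by omega⟩
  have e1 : ((β : ℤ) + 1).toNat = β + 1 := by omega
  have e2 : ((k : ℤ) + 1).toNat = k + 1 := by omega
  have e3 : ((k : ℤ) + 1 - 1).toNat = k := by omega
  rw [e1, e2, e3, entryNorm, entryNorm, Int.toNat_natCast, add_sub_cancel_right, zpow_neg, zpow_neg]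
  have h1 : q ^ (β : ℤ) ≠ 0 := zpow_ne_zero _ h0
  have h2 : q ^ (k : ℤ) ≠ 0 := zpow_ne_zero _ h0
  field_simp

theorem moveZ_apply_target (i x : ℤ) : moveZ i x x (i - 1) = 1 := by
  have h1 : ¬ (x = -1 - x) := by omega
  simp [moveZ, chiZ, h1]

theorem moveZ_apply_source (i x : ℤ) : moveZ i x x i = -1 := by
  have h1 : ¬ (x = -1 - x) := by omega
  have h2 : ¬ (i = i - 1) := by omega
  simp [moveZ, chiZ, h1, h2]

theorem moveZ_neg_neg (i x u v : ℤ) : moveZ i x (-1 - u) (-1 - v) = moveZ i x u v := by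
  simp only [moveZ, Pi.sub_apply]
  rw [← chiZ_symm, ← chiZ_symm]

theorem IsXi.normZ_move {a : ZMat} (ha : IsXi m n d a) {i x : ℤ} (hi : (-n : ℤ) < i)
    (hi' : i < n) (h0 : a x i ≠ 0) :
    normZ m n (a + moveZ i x) * (q ^ a x (i - 1) * qint (a x i)) =
      normZ m n a * (q ^ (a x i - 1) * qint (a x (i - 1) + 1)) := by
  have hs := ha.supp _ _ h0
  have hk := entryNorm_move (α := a x i) (β := a x (i - 1))
    (lt_of_le_of_ne (ha.nonneg _ _) h0.symm) (ha.nonneg _ _)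
  by_cases hx : 0 ≤ x
  · refine prod_prod_eq_of_two (x := x) (y := i - 1) (y' := i) (Finset.mem_Ico.2 (by omega))
      (Finset.mem_Ico.2 (by omega)) (Finset.mem_Ico.2 (by omega)) (by omega) ?_ ?_
    · have e1 : (a + moveZ i x) x (i - 1) = a x (i - 1) + 1 :=
        by rw [Pi.add_apply, Pi.add_apply, moveZ_apply_target]
      have e2 : (a + moveZ i x) x i = a x i - 1 := by
        rw [Pi.add_apply, Pi.add_apply, moveZ_apply_source, sub_eq_add_neg]
      rw [e1, e2, hk]
    · intro u v huv hu
      rw [Finset.mem_Ico] at hu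
      have : (a + moveZ i x) u v = a u v := by
        simp only [Pi.add_apply, moveZ, Pi.sub_apply, chiZ]
        split_ifs <;> omega
      rw [this]
  · refine prod_prod_eq_of_two (x := -1 - x) (y := -i) (y' := -1 - i)
      (Finset.mem_Ico.2 (by omega))
      (Finset.mem_Ico.2 (by omega)) (Finset.mem_Ico.2 (by omega)) (by omega) ?_ ?_
    · have s1 : a (-1 - x) (-i) = a x (i - 1) := by rw [ha.symm]; congr 1 <;> ring
      have s2 : a (-1 - x) (-1 - i) = a x i := (ha.symm _ _).symm
      have e1 : (a + moveZ i x) (-1 - x) (-i) = a x (i - 1) + 1 := by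
        rw [Pi.add_apply, Pi.add_apply, s1, ← moveZ_neg_neg, sub_sub_cancel,
          show -1 - -i = i - 1 by ring, moveZ_apply_target]
      have e2 : (a + moveZ i x) (-1 - x) (-1 - i) = a x i - 1 := by
        rw [Pi.add_apply, Pi.add_apply, s2, moveZ_neg_neg, moveZ_apply_source, sub_eq_add_neg]
      rw [e1, e2, s1, s2, hk]
    · intro u v huv hu
      rw [Finset.mem_Ico] at hu
      have : (a + moveZ i x) u v = a u v := by
        simp only [Pi.add_apply, moveZ, Pi.sub_apply, chiZ]
        split_ifs <;> omega
      rw [this]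

theorem IsXi.coefZ_adjoint {a : ZMat} (ha : IsXi m n d a) {i : ℤ} (hi : (-n : ℤ) < i)
    (hi' : i < n) {x : ℤ} (hx : (-m : ℤ) ≤ x) (hx' : x < m) (hb : IsXi m n d (a + moveZ i x)) :
    coefZ m i (some x) a * normZ m n (a + moveZ i x) =
      adjScale m i (a + moveZ i x) * coefZ m (-i) (some (-1 - x)) (a + moveZ i x) *
        normZ m n a := by
  have hq := q_ne_zero
  have e1 : (a + moveZ i x) x (i - 1) = a x (i - 1) + 1 :=
    by rw [Pi.add_apply, Pi.add_apply, moveZ_apply_target]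
  have e2 : (a + moveZ i x) x i = a x i - 1 := by
        rw [Pi.add_apply, Pi.add_apply, moveZ_apply_source, sub_eq_add_neg]
  have e3 : (a + moveZ i x) (-1 - x) (-i) = a x (i - 1) + 1 := by
    rw [← e1, hb.symm, show -1 - -i = i - 1 by ring, sub_sub_cancel]
  have h0 : a x i ≠ 0 := by
    have := hb.nonneg x i
    omega
  have hn := ha.normZ_move hi hi' h0
  simp only [coefZ, e3, hb.wtZ_neg i hx hx', sum_Ioo_add_moveZ i a hx, e1, e2, adjScale]
  set S := ∑ z ∈ Finset.Ioo x (m : ℤ), (a z i - a z (i - 1)) with hS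
  have hw : wtZ m i a x = S + if i = 0 ∧ x < 0 then 1 else 0 := rfl
  have key : (if i = 0 then 1 else q ^ (1 - (colZ m (a + moveZ i x) (i - 1) -
      colZ m (a + moveZ i x) i))) * (q ^ (colZ m (a + moveZ i x) (i - 1) -
      colZ m (a + moveZ i x) i + (a x i - 1 - (a x (i - 1) + 1)) +
        (S + if i = 0 ∧ x < 0 then 2 else 0) + if i = 0 ∧ 0 ≤ x then 1 else 0)) =
      q ^ (wtZ m i a x - a x (i - 1)) * q ^ (a x i - 1) := by
    rw [hw]
    by_cases hi0 : i = 0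
    · have hc : colZ m (a + moveZ i x) (i - 1) = colZ m (a + moveZ i x) i := by
        rw [← hb.colZ_neg, hi0]; rfl
      rw [if_pos hi0, hc, one_mul, ← zpow_add₀ hq]
      congr 1
      split_ifs <;> omega
    · rw [if_neg hi0, ← zpow_add₀ hq, ← zpow_add₀ hq]
      congr 1
      simp only [hi0, false_and, if_false]
      ring
  rw [← mul_assoc, key]
  have h3 : q ^ wtZ m i a x = q ^ (wtZ m i a x - a x (i - 1)) * q ^ a x (i - 1) := by
    rw [← zpow_add₀ hq, sub_add_cancel]
  rw [h3]
  linear_combination q ^ (wtZ m i a x - a x (i - 1)) * hn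

theorem adjoint_of_matrix_coeff {f g : Module.End K (VZ m n d)}
    (h : ∀ a b, IsXi m n d a → IsXi m n d b →
      formZ m n d (f (tZ m n d a)) (tZ m n d b) = formZ m n d (tZ m n d a) (g (tZ m n d b)))
    (u v : VZ m n d) : formZ m n d (f u) v = formZ m n d u (g v) := by
  have : (formZ m n d) ∘ₗ f = (formZ m n d).compl₂ g :=
    linearMap_ext_tZ fun a ha => linearMap_ext_tZ fun b hb => h a b ha hb
  exact congrArg (fun F => F u v) this

theorem diagZ_adjoint (g : ZMat → K) (u v : VZ m n d) :
    formZ m n d (diagZ m n d g u) v = formZ m n d u (diagZ m n d g v) := by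
  refine adjoint_of_matrix_coeff (fun a b ha hb => ?_) u v
  rw [diagZ_tZ g ha, diagZ_tZ g hb, map_smul, map_smul, LinearMap.smul_apply, formZ_tZ_tZ ha]
  split_ifs with h
  · rw [h]
  · simp

theorem add_moveZ_neg (a : ZMat) (i x : ℤ) : a + moveZ i x + moveZ (-i) (-1 - x) = a := by
  rw [moveZ, moveZ, ← chiZ_neg (-1 - x), ← chiZ_neg (-1 - x), sub_sub_cancel,
    show -1 - (-i - 1) = i by ring, show -1 - -i = i - 1 by ring]
  abel

theorem RZ_adjoint {i : ℤ} (hi : (-n : ℤ) < i) (hi' : i < n) (u v : VZ m n d) :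
    formZ m n d (RZ m n d i u) v =
      formZ m n d u ((RZ m n d (-i) * diagZ m n d (adjScale m i)) v) := by
  refine adjoint_of_matrix_coeff (fun a b ha hb => ?_) u v
  rw [Module.End.mul_apply, diagZ_tZ _ hb, map_smul, map_smul, RZ_tZ i ha, RZ_tZ (-i) hb,
    map_sum, map_sum, LinearMap.sum_apply, Finset.smul_sum]
  simp only [map_smul, LinearMap.smul_apply, formZ_tZ_tZ_right hb, smul_eq_mul]
  simp only [formZ_symm (tZ m n d a), formZ_tZ_tZ_right ha]
  rw [idxZ, Finset.sum_insertNone, Finset.sum_insertNone]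
  congr 1
  · simp only [coefZ, stepZ, add_zero, neg_eq_zero, adjScale]
    by_cases hi0 : i = 0
    · by_cases hab : a = b
      · simp [hi0, hab]
      · simp [hi0, hab, Ne.symm hab]
    · simp [hi0]
  · refine Finset.sum_nbij' (fun x => -1 - x) (fun x => -1 - x) (fun x hx => mem_Ico_neg.2 hx)
      (fun x hx => mem_Ico_neg.2 hx) (by simp) (by simp) fun x hx => ?_
    rw [Finset.mem_Ico] at hx
    by_cases hab : a + stepZ i (some x) = b
    · subst hab
      have h' : a + stepZ i (some x) + stepZ (-i) (some (-1 - x)) = a := add_moveZ_neg a i x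
      rw [if_pos rfl, if_pos h', ← mul_assoc]
      exact ha.coefZ_adjoint hi hi' hx.1 hx.2 hb
    · rw [if_neg hab, if_neg, mul_zero, mul_zero, mul_zero]
      rintro rfl
      apply hab
      have := add_moveZ_neg b (-i) (-1 - x)
      rwa [neg_neg, sub_sub_cancel] at this

theorem diagZ_adjScale {i : ℤ} (hi : (-n : ℤ) < i) (hi' : i < n) :
    diagZ m n d (adjScale m i) ∈ algR m n d := by
  by_cases h0 : i = 0
  · have : diagZ m n d (adjScale m i) = 1 := by
      refine linearMap_ext_tZ fun a ha => ?_
      rw [diagZ_tZ _ ha, adjScale, if_pos h0, one_smul]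
      rfl
    rw [this]
    exact one_mem _
  · have : diagZ m n d (adjScale m i) = q • (CZ m n d (i - 1) (-1) * CZ m n d i 1) := by
      refine linearMap_ext_tZ fun a ha => ?_
      rw [CZ, CZ, diagZ_mul, LinearMap.smul_apply, diagZ_tZ _ ha, diagZ_tZ _ ha, adjScale,
        if_neg h0, smul_smul, ← zpow_add₀ q_ne_zero, ← zpow_one_add₀ q_ne_zero]
      congr 2
      ring
    rw [this]
    exact Subalgebra.smul_mem _ (mul_mem (CZ_mem_algR (by omega) (by omega) (Or.inr rfl))
      (CZ_mem_algR (by omega) hi' (Or.inl rfl))) _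

theorem exists_adjoint_mem_algR {f : Module.End K (VZ m n d)} (hf : f ∈ algR m n d) :
    ∃ g ∈ algR m n d, ∀ u v, formZ m n d (f u) v = formZ m n d u (g v) := by
  refine exists_adjoint_of_mem_adjoin (formZ m n d) (gensZ m n d) ?_ hf
  rintro _ (⟨i, hi, hi', rfl⟩ | ⟨r, hr, hr', hO⟩)
  · exact ⟨_, mul_mem (RZ_mem_algR (by omega) (by omega)) (diagZ_adjScale hi hi'),
      RZ_adjoint hi hi'⟩
  · refine ⟨_, Algebra.subset_adjoin (Or.inr ⟨r, hr, hr', hO⟩), ?_⟩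
    rcases hO with rfl | rfl <;> exact diagZ_adjoint _

theorem centralizer_centralizer_algR :
    Subalgebra.centralizer K (Subalgebra.centralizer K
      (algR m n d : Set (Module.End K (VZ m n d))) : Set (Module.End K (VZ m n d))) =
        algR m n d := by
  have := isSemisimpleModule_of_adjoint (formZ m n d) formZ_symm (fun v => formZ_self_eq_zero)
    (algR m n d) fun f hf => exists_adjoint_mem_algR hf
  exact centralizer_centralizer_of_isSemisimpleModule (algR m n d)

end Adjoint

section Specialization

variable {m n d : ℕ}

/-- The pairs of an element of `ℚ[q, q⁻¹]` and its value at `q = 1`. -/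
def specRing : Subring (K × ℚ) where
  carrier := {z | ∃ (p : Polynomial ℚ) (N : ℕ),
    z.1 * q ^ N = algebraMap (Polynomial ℚ) K p ∧ z.2 = p.eval 1}
  mul_mem' := by
    rintro z w ⟨p, N, h1, h2⟩ ⟨p', N', h1', h2'⟩
    refine ⟨p * p', N + N', ?_, ?_⟩
    · rw [map_mul, ← h1, ← h1', Prod.fst_mul]
      ring
    · rw [Polynomial.eval_mul, Prod.snd_mul, h2, h2']
  one_mem' := ⟨1, 0, by simp, by simp⟩
  add_mem' := by
    rintro z w ⟨p, N, h1, h2⟩ ⟨p', N', h1', h2'⟩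
    refine ⟨p * Polynomial.X ^ N' + p' * Polynomial.X ^ N, N + N', ?_, ?_⟩
    · have hX : algebraMap (Polynomial ℚ) K Polynomial.X = q := RatFunc.algebraMap_X
      rw [map_add, map_mul, map_mul, map_pow, map_pow, hX, ← h1, ← h1', Prod.fst_add]
      ring
    · simp [h2, h2']
  zero_mem' := ⟨0, 0, by simp, by simp⟩
  neg_mem' := by
    rintro z ⟨p, N, h1, h2⟩
    refine ⟨-p, N, ?_, ?_⟩
    · rw [map_neg, ← h1, Prod.fst_neg, neg_mul]
    · rw [Polynomial.eval_neg, Prod.snd_neg, h2]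

theorem snd_eq_zero_of_mem_specRing {z : K × ℚ} (hz : z ∈ specRing) (h : z.1 = 0) : z.2 = 0 := by
  obtain ⟨p, N, h1, h2⟩ := hz
  rw [h, zero_mul] at h1
  have : p = 0 := RatFunc.algebraMap_injective ℚ (by rw [← h1, map_zero])
  rw [h2, this, Polynomial.eval_zero]

theorem zpow_mem_specRing (k : ℤ) : (q ^ k, (1 : ℚ)) ∈ specRing := by
  have hX : algebraMap (Polynomial ℚ) K Polynomial.X = q := RatFunc.algebraMap_X
  rcases Int.eq_nat_or_neg k with ⟨N, rfl | rfl⟩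
  · exact ⟨Polynomial.X ^ N, 0, by simp [hX], by simp⟩
  · refine ⟨1, N, ?_, by simp⟩
    change q ^ (-(N : ℤ)) * q ^ N = _
    rw [zpow_neg, zpow_natCast, inv_mul_cancel₀ (pow_ne_zero _ q_ne_zero), map_one]

theorem rat_mem_specRing (c : ℚ) : (algebraMap ℚ K c, c) ∈ specRing :=
  ⟨Polynomial.C c, 0, by
    rw [pow_zero, mul_one, RatFunc.algebraMap_C]
    exact RingHom.congr_fun (RingHom.ext_rat (algebraMap ℚ K) RatFunc.C) c, by simp⟩

theorem qint_mem_specRing {k : ℤ} (hk : 0 ≤ k) : (qint k, (k : ℚ)) ∈ specRing := by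
  induction k, hk using Int.leInduction with
  | base =>
    rw [qint_zero, Int.cast_zero]
    exact zero_mem specRing
  | succ k hk ih =>
    rw [qint_succ', ← zpow_neg_one]
    convert add_mem (mul_mem (zpow_mem_specRing (-1)) ih) (zpow_mem_specRing k) using 1
    simp

/-- The vector `p` is a value at `q = 1` of the vector `v`. -/
def IsSpec (v : VZ m n d) (p : XiZ m n d →₀ ℚ) : Prop := ∀ a, (v a, p a) ∈ specRing

theorem IsSpec.zero : IsSpec (0 : VZ m n d) 0 := fun _ => zero_mem _

theorem IsSpec.add {v v' : VZ m n d} {p p' : XiZ m n d →₀ ℚ} (h : IsSpec v p)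
    (h' : IsSpec v' p') : IsSpec (v + v') (p + p') := fun a => add_mem (h a) (h' a)

theorem IsSpec.smul {v : VZ m n d} {p : XiZ m n d →₀ ℚ} (h : IsSpec v p) {c : K} {r : ℚ}
    (hc : (c, r) ∈ specRing) : IsSpec (c • v) (r • p) := fun a => mul_mem hc (h a)

theorem IsSpec.sum {ι : Type*} {s : Finset ι} {v : ι → VZ m n d} {p : ι → XiZ m n d →₀ ℚ}
    (h : ∀ x ∈ s, IsSpec (v x) (p x)) : IsSpec (∑ x ∈ s, v x) (∑ x ∈ s, p x) := by
  induction s using Finset.induction_on with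
  | empty => simpa using IsSpec.zero
  | insert x s hx ih =>
    rw [Finset.sum_insert hx, Finset.sum_insert hx]
    exact (h x (Finset.mem_insert_self x s)).add
      (ih fun y hy => h y (Finset.mem_insert_of_mem hy))

/-- The basis vector indexed by `a` over `ℚ`, zero if `a` is not an index. -/
def tQ (m n d : ℕ) (a : ZMat) : XiZ m n d →₀ ℚ :=
  if h : IsXi m n d a then Finsupp.single ⟨a, h⟩ 1 else 0

theorem tQ_of_isXi {a : ZMat} (h : IsXi m n d a) : tQ m n d a = Finsupp.single ⟨a, h⟩ 1 :=
  dif_pos h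

theorem IsSpec.basis (a : ZMat) : IsSpec (tZ m n d a) (tQ m n d a) := by
  intro b
  by_cases h : IsXi m n d a
  · rw [tZ_of_isXi h, tQ_of_isXi h, Finsupp.single_apply, Finsupp.single_apply]
    split_ifs
    · exact one_mem _
    · exact zero_mem _
  · rw [tZ, tQ, dif_neg h, dif_neg h]
    exact zero_mem _

/-- The operator moving a unit from column `k` to column `c` in all possible ways. -/
def XQ (m n d : ℕ) (c k : ℤ) : Module.End ℚ (XiZ m n d →₀ ℚ) :=
  Finsupp.lift (XiZ m n d →₀ ℚ) ℚ (XiZ m n d) fun a =>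
    ∑ x ∈ Finset.Ico (-m : ℤ) m, (a.1 x k : ℚ) • tQ m n d (a.1 + (chiZ x c - chiZ x k))

theorem XQ_tQ (c k : ℤ) {a : ZMat} (h : IsXi m n d a) :
    XQ m n d c k (tQ m n d a) =
      ∑ x ∈ Finset.Ico (-m : ℤ) m, (a x k : ℚ) • tQ m n d (a + (chiZ x c - chiZ x k)) := by
  simp [XQ, tQ_of_isXi h]

theorem IsSpec.RZ {v : VZ m n d} {p : XiZ m n d →₀ ℚ} (h : IsSpec v p) (i : ℤ) :
    IsSpec (RZ m n d i v) (XQ m n d (i - 1) i p + (if i = 0 then 1 else 0 : ℚ) • p) := by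
  let _ : Fintype (XiZ m n d) := Fintype.ofFinite _
  have hv : v = ∑ a : XiZ m n d, v a • tZ m n d a.1 := by
    conv_lhs => rw [← Finsupp.univ_sum_single v]
    refine Finset.sum_congr rfl fun a _ => ?_
    rw [tZ_of_isXi a.2]
    simp
  have hp : p = ∑ a : XiZ m n d, p a • tQ m n d a.1 := by
    conv_lhs => rw [← Finsupp.univ_sum_single p]
    refine Finset.sum_congr rfl fun a _ => ?_
    rw [tQ_of_isXi a.2]
    simp
  rw [hv, hp, map_sum, map_sum, Finset.smul_sum, ← Finset.sum_add_distrib]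
  refine IsSpec.sum fun a _ => ?_
  rw [map_smul, map_smul, smul_comm, ← smul_add]
  refine IsSpec.smul ?_ (h a)
  rw [RZ_tZ i a.2, XQ_tQ _ _ a.2, idxZ, Finset.sum_insertNone, add_comm]
  refine IsSpec.add (IsSpec.sum fun x _ => ?_) ?_
  · refine (IsSpec.basis _).smul ?_
    have := mul_mem (zpow_mem_specRing (wtZ m i a.1 x)) (qint_mem_specRing (a.2.nonneg x i))
    simpa [coefZ] using this
  · simp only [stepZ, add_zero]
    refine (IsSpec.basis _).smul ?_
    simp only [coefZ]
    split_ifs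
    · exact zpow_mem_specRing _
    · exact zero_mem _

/-- The values at `q = 1` of the vectors of a subspace. -/
def specSubmodule (N : Submodule K (VZ m n d)) : Submodule ℚ (XiZ m n d →₀ ℚ) where
  carrier := {p | ∃ v ∈ N, IsSpec v p}
  add_mem' := by
    rintro p p' ⟨v, hv, h⟩ ⟨v', hv', h'⟩
    exact ⟨v + v', add_mem hv hv', h.add h'⟩
  zero_mem' := ⟨0, zero_mem _, IsSpec.zero⟩
  smul_mem' := by
    rintro c p ⟨v, hv, h⟩
    exact ⟨algebraMap ℚ K c • v, N.smul_mem _ hv, h.smul (rat_mem_specRing c)⟩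

theorem eq_top_of_specSubmodule_eq_top {N : Submodule K (VZ m n d)}
    (h : ∀ a, IsXi m n d a → tQ m n d a ∈ specSubmodule N) : N = ⊤ := by
  let _ : Fintype (XiZ m n d) := Fintype.ofFinite _
  choose v hv hs using fun a : XiZ m n d => h a.1 a.2
  let M : Matrix (XiZ m n d) (XiZ m n d) specRing :=
    fun a b => ⟨(v a b, tQ m n d a.1 b), hs a b⟩
  let F : specRing →+* K := (RingHom.fst K ℚ).comp specRing.subtype
  let G : specRing →+* ℚ := (RingHom.snd K ℚ).comp specRing.subtype
  have hG : G M.det = 1 := by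
    rw [RingHom.map_det]
    have : G.mapMatrix M = 1 := by
      ext a b
      change tQ m n d a.1 b = _
      rw [tQ_of_isXi a.2, Finsupp.single_apply, Matrix.one_apply]
    rw [this, Matrix.det_one]
  have hF : IsUnit (F.mapMatrix M).det := by
    rw [← RingHom.map_det, isUnit_iff_ne_zero]
    intro h0
    have := snd_eq_zero_of_mem_specRing M.det.2 h0
    exact one_ne_zero (hG.symm.trans this)
  have hinv := Matrix.nonsing_inv_mul _ hF
  rw [eq_top_iff]
  intro u _
  rw [sum_smul_tZ u]
  refine Submodule.sum_mem _ fun a _ => N.smul_mem _ ?_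
  have : tZ m n d a.1 = ∑ b, (F.mapMatrix M)⁻¹ a b • v b := by
    ext c
    have hc := congrFun (congrFun hinv a) c
    rw [Matrix.mul_apply, Matrix.one_apply] at hc
    rw [tZ_of_isXi a.2, Finsupp.single_apply, Finsupp.finsetSum_apply]
    exact hc.symm
  rw [this]
  exact Submodule.sum_mem _ fun b _ => N.smul_mem _ (hv b)

end Specialization

section Generation

variable {m n d : ℕ}

theorem chiZ_self_eq (r c : ℤ) : chiZ r c r c = 1 := by
  have h1 : ¬ (r = -1 - r) := by omega
  simp [chiZ, h1]

theorem chiZ_nonneg (r c u v : ℤ) : 0 ≤ chiZ r c u v := by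
  unfold chiZ
  positivity

theorem IsXi.add_chiZ_sub_chiZ {a : ZMat} (h : IsXi m n d a) {r c x l : ℤ}
    (hr : (-m : ℤ) ≤ r ∧ r < m) (hc : (-n : ℤ) ≤ c ∧ c < n) (ha : a x l ≠ 0) :
    IsXi m n d (a + (chiZ r c - chiZ x l)) := by
  refine h.add_chiZ_sub hr hc ha fun u v => ?_
  have h1 := chiZ_nonneg r c u v
  have h2 := h.nonneg u v
  simp only [Pi.add_apply, Pi.sub_apply]
  by_cases h0 : chiZ x l u v = 0
  · omega
  · have h3 := h.nonneg x l
    have h4 : chiZ x l u v = 1 ∧ a u v = a x l := by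
      rcases chiZ_ne_zero h0 with ⟨rfl, rfl⟩ | ⟨rfl, rfl⟩
      · exact ⟨chiZ_self_eq _ _, rfl⟩
      · exact ⟨by rw [← chiZ_symm, chiZ_self_eq], (h.symm _ _).symm⟩
    omega

theorem XQ_XQ_tQ {c k c' l : ℤ} (hc' : (-n : ℤ) ≤ c' ∧ c' < n) {a : ZMat} (h : IsXi m n d a) :
    XQ m n d c k (XQ m n d c' l (tQ m n d a)) =
      ∑ x ∈ Finset.Ico (-m : ℤ) m, ∑ y ∈ Finset.Ico (-m : ℤ) m,
        ((a x l * (a + (chiZ x c' - chiZ x l)) y k : ℤ) : ℚ) •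
          tQ m n d (a + (chiZ x c' - chiZ x l) + (chiZ y c - chiZ y k)) := by
  rw [XQ_tQ _ _ h, map_sum]
  refine Finset.sum_congr rfl fun x hx => ?_
  rw [map_smul]
  by_cases h0 : a x l = 0
  · simp [h0]
  · rw [XQ_tQ _ _ (h.add_chiZ_sub_chiZ (Finset.mem_Ico.1 hx) hc' h0), Finset.smul_sum]
    refine Finset.sum_congr rfl fun y _ => ?_
    rw [smul_smul, Int.cast_mul]

theorem IsXi.bracket_coeff {a : ZMat} (h : IsXi m n d a) {c k l : ℤ} (hcl : c ≠ l) (hkl : k ≠ l)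
    (x y : ℤ) :
    a x l * (a + (chiZ x k - chiZ x l)) y k - a y k * (a + (chiZ y c - chiZ y k)) x l =
      (if y = x then a x l else 0) -
        if y = -1 - x then (if c = -1 - l then a y k else 0) else 0 := by
  have e1 : chiZ x k y k = if y = x then 1 else 0 := by
    have : ¬ (k = -1 - k) := by omega
    simp [chiZ, this]
  have e2 : chiZ x l y k = if y = -1 - x ∧ k = -1 - l then 1 else 0 := by
    simp [chiZ, hkl]
  have e3 : chiZ y c x l = if y = -1 - x ∧ c = -1 - l then 1 else 0 := by
    simp only [chiZ, hcl.symm, and_false, if_false, zero_add]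
    exact if_congr (by constructor <;> intro h <;> omega) rfl rfl
  have e4 : chiZ y k x l = if y = -1 - x ∧ k = -1 - l then 1 else 0 := by
    simp only [chiZ, hkl.symm, and_false, if_false, zero_add]
    exact if_congr (by constructor <;> intro h <;> omega) rfl rfl
  have e5 : y = -1 - x ∧ k = -1 - l → a y k = a x l := by
    rintro ⟨rfl, rfl⟩
    exact (h.symm x l).symm
  simp only [Pi.add_apply, Pi.sub_apply, e1, e2, e3, e4]
  by_cases p1 : y = -1 - x
  · by_cases p2 : k = -1 - l
    · rw [e5 ⟨p1, p2⟩]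
      simp only [p1, p2, true_and]
      split_ifs <;> ring
    · simp only [p1, p2, true_and]
      split_ifs <;> simp_all <;> ring
  · simp only [p1, false_and, if_false]
    split_ifs <;> ring

theorem XQ_bracket {c k l : ℤ} (hc : (-n : ℤ) ≤ c ∧ c < n) (hk : (-n : ℤ) ≤ k ∧ k < n)
    (hcl : c ≠ l) (hkl : k ≠ l) {a : ZMat} (h : IsXi m n d a) :
    XQ m n d c k (XQ m n d k l (tQ m n d a)) - XQ m n d k l (XQ m n d c k (tQ m n d a)) =
      XQ m n d c l (tQ m n d a) -
        if c = -1 - l then XQ m n d (-1 - k) k (tQ m n d a) else 0 := by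
  rw [XQ_XQ_tQ hk h, XQ_XQ_tQ hc h]
  conv_lhs => rw [Finset.sum_comm (γ := ℤ) (s := Finset.Ico (-m : ℤ) m) (f := fun y x =>
    ((a y k * (a + (chiZ y c - chiZ y k)) x l : ℤ) : ℚ) •
          tQ m n d (a + (chiZ y c - chiZ y k) + (chiZ x k - chiZ x l)))]
  have hT : ∀ x y, a + (chiZ y c - chiZ y k) + (chiZ x k - chiZ x l) =
      a + (chiZ x k - chiZ x l) + (chiZ y c - chiZ y k) := fun x y => by abel
  simp only [hT, ← Finset.sum_sub_distrib, ← sub_smul, ← Int.cast_sub, h.bracket_coeff hcl hkl]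
  simp only [Int.cast_sub, sub_smul, Finset.sum_sub_distrib]
  congr 1
  · rw [XQ_tQ _ _ h]
    refine Finset.sum_congr rfl fun x hx => ?_
    rw [Finset.sum_eq_single x]
    · rw [if_pos rfl]
      congr 2
      abel
    · intro y _ hy
      rw [if_neg hy, Int.cast_zero, zero_smul]
    · exact fun hx' => absurd hx hx'
  · split_ifs with hcl'
    · rw [XQ_tQ _ _ h, ← sum_Ico_neg m fun x => _]
      refine Finset.sum_congr rfl fun x hx => ?_
      rw [Finset.sum_eq_single x]
      · rw [if_pos (sub_sub_cancel _ _).symm, hcl', ← chiZ_neg x (-1 - l), ← chiZ_neg x (-1 - k),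
          sub_sub_cancel, sub_sub_cancel]
        congr 2
        abel
      · intro y _ hy
        rw [sub_sub_cancel, if_neg hy, Int.cast_zero, zero_smul]
      · exact fun hx' => absurd hx hx'
    · simp

theorem linearMap_ext_tQ {W : Type*} [AddCommGroup W] [Module ℚ W]
    {f g : (XiZ m n d →₀ ℚ) →ₗ[ℚ] W} (h : ∀ a, IsXi m n d a → f (tQ m n d a) = g (tQ m n d a)) :
    f = g := by
  refine Finsupp.lhom_ext' fun a => LinearMap.ext_ring ?_
  have h' := h a.1 a.2
  rw [tQ_of_isXi a.2] at h'
  exact h'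

theorem XQ_eq_bracket {c k l : ℤ} (hc : (-n : ℤ) ≤ c ∧ c < n) (hk : (-n : ℤ) ≤ k ∧ k < n)
    (hcl : c ≠ l) (hkl : k ≠ l) :
    XQ m n d c l = XQ m n d c k * XQ m n d k l - XQ m n d k l * XQ m n d c k +
        if c = -1 - l then XQ m n d (-1 - k) k else 0 := by
  refine linearMap_ext_tQ fun a ha => ?_
  have := XQ_bracket hc hk hcl hkl ha
  rw [LinearMap.add_apply, LinearMap.sub_apply, Module.End.mul_apply, Module.End.mul_apply, this]
  split_ifs <;> simp

theorem XQ_neg (c k : ℤ) : XQ m n d (-1 - c) (-1 - k) = XQ m n d c k := by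
  refine linearMap_ext_tQ fun a ha => ?_
  rw [XQ_tQ _ _ ha, XQ_tQ _ _ ha, ← sum_Ico_neg m fun x => _]
  refine Finset.sum_congr rfl fun x _ => ?_
  rw [chiZ_neg, chiZ_neg, ← ha.symm]

theorem XQ_mem_of_lt {N : Submodule ℚ (XiZ m n d →₀ ℚ)}
    (hN : ∀ i : ℤ, -n < i → i < n → ∀ p ∈ N, XQ m n d (i - 1) i p ∈ N) (g : ℕ) :
    ∀ c l : ℤ, l - c = g + 1 → (-n : ℤ) ≤ c → l < n → ∀ p ∈ N, XQ m n d c l p ∈ N := by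
  induction g using Nat.strong_induction_on with
  | _ g ih =>
    intro c l hg hc hl p hp
    rcases Nat.eq_zero_or_pos g with rfl | hg0
    · obtain rfl : c = l - 1 := by push_cast at hg; omega
      exact hN l (by omega) hl p hp
    · have hstep : ∀ p ∈ N, XQ m n d (l - 1) l p ∈ N := hN l (by omega) hl
      have hc' : ∀ p ∈ N, XQ m n d c (l - 1) p ∈ N :=
        ih (g - 1) (by omega) c (l - 1) (by omega) hc (by omega)
      rw [XQ_eq_bracket (k := l - 1) (c := c) (by omega) (by omega) (by omega) (by omega),
        LinearMap.add_apply, LinearMap.sub_apply, Module.End.mul_apply, Module.End.mul_apply]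
      refine add_mem (sub_mem (hc' _ (hstep p hp)) (hstep _ (hc' p hp))) ?_
      split_ifs with h
      · exact ih (2 * (l - 1)).toNat (by omega) _ _ (by omega) (by omega) (by omega) p hp
      · exact zero_mem _

theorem XQ_mem {N : Submodule ℚ (XiZ m n d →₀ ℚ)}
    (hN : ∀ i : ℤ, -n < i → i < n → ∀ p ∈ N, XQ m n d (i - 1) i p ∈ N) {c l : ℤ} (hcl : c ≠ l)
    (hc : (-n : ℤ) ≤ c ∧ c < n) (hl : (-n : ℤ) ≤ l ∧ l < n) {p} (hp : p ∈ N) :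
    XQ m n d c l p ∈ N := by
  rcases lt_or_gt_of_ne hcl with h | h
  · exact XQ_mem_of_lt hN (l - c - 1).toNat c l (by omega) hc.1 hl.2 p hp
  · rw [← XQ_neg]
    exact XQ_mem_of_lt hN (c - l - 1).toNat _ _ (by omega) (by omega) (by omega) p hp

/-- The sum of the diagonal entries. -/
def traceZ (m : ℕ) (a : ZMat) : ℤ := ∑ x ∈ Finset.Ico (-m : ℤ) m, a x x

theorem traceZ_add (a b : ZMat) : traceZ m (a + b) = traceZ m a + traceZ m b :=
  Finset.sum_add_distrib

theorem traceZ_sub (a b : ZMat) : traceZ m (a - b) = traceZ m a - traceZ m b :=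
  Finset.sum_sub_distrib _ _

theorem traceZ_chiZ {r : ℤ} (hr : (-m : ℤ) ≤ r ∧ r < m) (c : ℤ) :
    traceZ m (chiZ r c) = if r = c then 2 else 0 := by
  have h : ∀ r c : ℤ, (-m : ℤ) ≤ r ∧ r < m →
      ∑ x ∈ Finset.Ico (-m : ℤ) m, (if x = r ∧ x = c then (1 : ℤ) else 0) =
        if r = c then 1 else 0 := by
    intro r c hr
    rw [Finset.sum_eq_single r]
    · simp
    · intro x _ hx
      simp [hx]
    · exact fun h => absurd (Finset.mem_Ico.2 hr) h
  simp only [traceZ, chiZ]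
  rw [Finset.sum_add_distrib, h r c hr, h (-1 - r) (-1 - c) (by omega)]
  split_ifs <;> omega

theorem IsXi.traceZ_le {a : ZMat} (h : IsXi m n d a) : traceZ m a ≤ 2 * d := by
  rw [← h.total]
  refine Finset.sum_le_sum fun x _ => ?_
  by_cases h0 : a x x = 0
  · rw [h0]
    exact Finset.sum_nonneg fun y _ => h.nonneg x y
  · exact Finset.single_le_sum (f := fun y => a x y) (fun y _ => h.nonneg x y)
      (Finset.mem_Ico.2 (h.supp _ _ h0).2)

theorem tQ_mem_of_XQ_stable {N : Submodule ℚ (XiZ m n d →₀ ℚ)}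
    (hN : ∀ i : ℤ, -n < i → i < n → ∀ p ∈ N, XQ m n d (i - 1) i p ∈ N)
    (hdiag : ∀ a, IsXi m n d a → (∀ x y, a x y ≠ 0 → x = y) → tQ m n d a ∈ N)
    (hbad : ∀ a, IsXi m n d a → ∀ x y, a x y ≠ 0 → ¬ ((-n : ℤ) ≤ x ∧ x < n) → tQ m n d a ∈ N)
    (g : ℕ) : ∀ a, IsXi m n d a → 2 * d - traceZ m a < g → tQ m n d a ∈ N := by
  induction g with
  | zero =>
    intro a ha hg
    have := ha.traceZ_le
    push_cast at hg
    omega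
  | succ g ih =>
    intro a ha hg
    push_cast at hg
    by_cases h : ∃ k c, a k c ≠ 0 ∧ k ≠ c
    · obtain ⟨k, c, h0, hkc⟩ := h
      by_cases hk : (-n : ℤ) ≤ k ∧ k < n
      · have hs := ha.supp _ _ h0
        have hb := ha.add_chiZ_sub_chiZ hs.1 hk h0
        set b := a + (chiZ k k - chiZ k c) with hbdef
        have htr : traceZ m b = traceZ m a + 2 := by
          rw [traceZ_add, traceZ_sub, traceZ_chiZ hs.1, traceZ_chiZ hs.1, if_pos rfl, if_neg hkc,
            sub_zero]
        have hbN := XQ_mem hN (Ne.symm hkc) hs.2 hk (ih b hb (by omega))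
        rw [XQ_tQ _ _ hb, ← Finset.add_sum_erase _ _ (Finset.mem_Ico.2 hs.1)] at hbN
        have hrest : ∑ x ∈ (Finset.Ico (-m : ℤ) m).erase k,
            (b x k : ℚ) • tQ m n d (b + (chiZ x c - chiZ x k)) ∈ N := by
          refine Submodule.sum_mem _ fun x hx => ?_
          rw [Finset.mem_erase, Finset.mem_Ico] at hx
          by_cases hxk : b x k = 0
          · rw [hxk, Int.cast_zero, zero_smul]
            exact zero_mem _
          · refine N.smul_mem _ (ih _ (hb.add_chiZ_sub_chiZ hx.2 hs.2 hxk) ?_)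
            rw [traceZ_add, traceZ_sub, traceZ_chiZ hx.2, traceZ_chiZ hx.2, if_neg hx.1, htr]
            split_ifs <;> omega
        have hab : b + (chiZ k c - chiZ k k) = a := by
          rw [hbdef]
          abel
        have hbk : b k k ≠ 0 := by
          have h1 := ha.nonneg k k
          have h2 : chiZ k c k k = 0 := by
            by_contra h'
            rcases chiZ_ne_zero h' with h' | h' <;> omega
          rw [hbdef, Pi.add_apply, Pi.add_apply, Pi.sub_apply, Pi.sub_apply, chiZ_self_eq, h2]
          omega
        have := (add_mem_cancel_right hrest).1 hbN
        rw [hab] at this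
        exact (N.smul_mem_iff (Int.cast_ne_zero.2 hbk)).1 this
      · exact hbad a ha k c h0 hk
    · exact hdiag a ha fun x y hxy => by
        by_contra hne
        exact h ⟨x, y, hxy, hne⟩

theorem eq_top_of_RZ_stable {N : Submodule K (VZ m n d)}
    (hN : ∀ i : ℤ, -n < i → i < n → ∀ v ∈ N, RZ m n d i v ∈ N)
    (hdiag : ∀ a, IsXi m n d a → (∀ x y, a x y ≠ 0 → x = y) → tZ m n d a ∈ N)
    (hbad : ∀ a, IsXi m n d a → ∀ x y, a x y ≠ 0 → ¬ ((-n : ℤ) ≤ x ∧ x < n) → tZ m n d a ∈ N) :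
    N = ⊤ := by
  refine eq_top_of_specSubmodule_eq_top fun a ha =>
    tQ_mem_of_XQ_stable (N := specSubmodule N) (fun i hi hi' p hp => ?_)
      (fun b hb h => ⟨_, hdiag b hb h, IsSpec.basis b⟩)
      (fun b hb x y h h' => ⟨_, hbad b hb x y h h', IsSpec.basis b⟩)
      (2 * d - traceZ m a + 1).toNat a ha (by have := ha.traceZ_le; omega)
  obtain ⟨v, hv, hs⟩ := hp
  have h1 : XQ m n d (i - 1) i p + (if i = 0 then 1 else 0 : ℚ) • p ∈ specSubmodule N :=
    ⟨_, hN i hi hi' v hv, hs.RZ i⟩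
  exact (add_mem_cancel_right ((specSubmodule N).smul_mem _ ⟨v, hv, hs⟩)).1 h1

end Generation

section DoubleCentralizer

variable {m n d : ℕ}

theorem diagZ_apply (g : ZMat → K) (v : VZ m n d) (a : XiZ m n d) :
    diagZ m n d g v a = g a.1 * v a := by
  have : Finsupp.lapply a ∘ₗ diagZ m n d g = g a.1 • Finsupp.lapply a := by
    refine linearMap_ext_tZ fun b hb => ?_
    rw [LinearMap.comp_apply, diagZ_tZ g hb, map_smul, LinearMap.smul_apply, Finsupp.lapply_apply,
      tZ_apply a.2, smul_eq_mul, smul_eq_mul]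
    split_ifs with h
    · rw [h]
    · simp
  exact congrArg (fun F => F v) this

theorem IsXi.colZ_eq_zero {a : ZMat} (h : IsXi m n d a) {r : ℤ} (hr : ¬ ((-n : ℤ) ≤ r ∧ r < n)) :
    colZ m a r = 0 := by
  refine Finset.sum_eq_zero fun x _ => ?_
  by_contra h0
  exact hr (h.supp _ _ h0).2

/-- The vectors obtained from `v` by the right action. -/
def cyclicZ (v : VZ m n d) : Submodule K (VZ m n d) :=
  (Subalgebra.toSubmodule (algR m n d)).map (LinearMap.applyₗ v)

theorem mem_cyclicZ {v w : VZ m n d} : w ∈ cyclicZ v ↔ ∃ r ∈ algR m n d, r v = w := Iff.rfl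

theorem tZ_mem_cyclicZ {a b : ZMat} (ha : IsXi m n d a) (hdiag : ∀ x y, a x y ≠ 0 → x = y)
    (hb : IsXi m n d b) (hab : ∀ x, colZ n (trMat b) x = colZ n (trMat a) x) :
    tZ m n d b ∈ cyclicZ (tZ m n d a) := by
  let g : ZMat → K := fun c => if ∀ x, colZ n (trMat c) x = colZ n (trMat a) x then 1 else 0
  have hg : ∀ i : ℤ, (-n : ℤ) < i → i < n → ∀ v,
      diagZ m n d g (RZ m n d i v) = RZ m n d i (diagZ m n d g v) := by
    intro i hi hi' v
    have h : diagZ n m d (fun c => g (trMat c)) * LZ n m d i =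
        LZ n m d i * diagZ n m d fun c => g (trMat c) := by
      refine diagZ_comm_LZ hi hi' fun c o => ?_
      have : ∀ x, colZ n (trMat (trMat (c + trMat (stepZ i o)))) x =
          colZ n (trMat (trMat c)) x := fun x => colZ_add_trMat_stepZ hi hi' c o x
      simp only [g, this]
    have h' := congrArg (trAlg n m d) h
    rw [map_mul, map_mul, trAlg_LZ, trAlg_diagZ] at h'
    exact congrArg (fun F => F v) h'
  have htop : (cyclicZ (tZ m n d a)).comap (diagZ m n d g) = ⊤ := by
    refine eq_top_of_RZ_stable (fun i hi hi' v hv => ?_) (fun c hc hcd => ?_)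
      fun c hc x y hxy hx => ?_
    · rw [Submodule.mem_comap] at hv ⊢
      obtain ⟨r, hr, hrv⟩ := mem_cyclicZ.1 hv
      rw [hg i hi hi', ← hrv]
      exact mem_cyclicZ.2 ⟨RZ m n d i * r, mul_mem (RZ_mem_algR hi hi') hr, rfl⟩
    · rw [Submodule.mem_comap, diagZ_tZ g hc]
      by_cases h : ∀ x, colZ n (trMat c) x = colZ n (trMat a) x
      · have hca : c = a := by
          have key : ∀ {e : ZMat}, IsXi m n d e → (∀ x y, e x y ≠ 0 → x = y) → ∀ x y,
              e x y = if x = y then colZ n (trMat e) x else 0 := by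
            intro e he hed x y
            split_ifs with hxy
            · subst hxy
              rw [colZ, Finset.sum_eq_single x]
              · rfl
              · intro y _ hy
                by_contra h0
                exact hy (hed _ _ h0).symm
              · intro hx
                by_contra h0
                exact hx (Finset.mem_Ico.2 (he.supp _ _ h0).2)
            · by_contra h0
              exact hxy (hed _ _ h0)
          funext x y
          rw [key hc hcd, key ha hdiag, h]
        rw [hca]
        exact Submodule.smul_mem _ _ (mem_cyclicZ.2 ⟨1, one_mem _, rfl⟩)
      · rw [show g c = 0 from if_neg h, zero_smul]
        exact zero_mem _
    · have h : ¬ ∀ x, colZ n (trMat c) x = colZ n (trMat a) x := by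
        intro h
        have h1 : colZ n (trMat a) x = 0 := by
          refine Finset.sum_eq_zero fun z _ => ?_
          by_contra h0
          have h0' : a x z ≠ 0 := h0
          have hxz := hdiag _ _ h0'
          exact hx (hxz ▸ (ha.supp _ _ h0').2)
        have h2 := (Finset.sum_eq_zero_iff_of_nonneg fun z _ => hc.nonneg x z).1 ((h x).trans h1)
          y (Finset.mem_Ico.2 (hc.supp _ _ hxy).2)
        exact hxy h2
      rw [Submodule.mem_comap, diagZ_tZ g hc, show g c = 0 from if_neg h, zero_smul]
      exact zero_mem _
  have hmem : tZ m n d b ∈ (cyclicZ (tZ m n d a)).comap (diagZ m n d g) := htop ▸ Submodule.mem_top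
  rw [Submodule.mem_comap, diagZ_tZ g hb, show g b = 1 from if_pos hab, one_smul] at hmem
  exact hmem

theorem apply_eq_zero_of_centralizer {f : Module.End K (VZ m n d)}
    (hf : f ∈ Subalgebra.centralizer K (algR m n d : Set (Module.End K (VZ m n d))))
    {a : ZMat} (ha : IsXi m n d a) (b : XiZ m n d) (hb : f (tZ m n d a) b ≠ 0) (r : ℤ) :
    colZ m b.1 r = colZ m a r := by
  by_cases hr : (-n : ℤ) ≤ r ∧ r < n
  · have h := (Subalgebra.mem_centralizer_iff K).1 hf _
      (CZ_mem_algR (m := m) (d := d) hr.1 hr.2 (Or.inl rfl))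
    have h' : CZ m n d r 1 (f (tZ m n d a)) b = f (CZ m n d r 1 (tZ m n d a)) b :=
      congrArg (fun F : Module.End K (VZ m n d) => F (tZ m n d a) b) h
    rw [CZ, diagZ_apply, diagZ_tZ _ ha, map_smul, Finsupp.smul_apply, smul_eq_mul] at h'
    have := q_zpow_injective (mul_right_cancel₀ hb h')
    omega
  · rw [b.2.colZ_eq_zero hr, ha.colZ_eq_zero hr]

theorem trZ_trZ (v : VZ m n d) : trZ n m d (trZ m n d v) = v := by
  rw [← trZ_symm, LinearEquiv.symm_apply_apply]

theorem trAlg_mem_centralizer {f : Module.End K (VZ m n d)} :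
    trAlg m n d f ∈ Subalgebra.centralizer K (algR n m d : Set (Module.End K (VZ n m d))) ↔
      f ∈ Subalgebra.centralizer K (algL m n d : Set (Module.End K (VZ m n d))) := by
  rw [Subalgebra.mem_centralizer_iff, Subalgebra.mem_centralizer_iff]
  constructor
  · intro h g hg
    apply (trAlg m n d).injective
    rw [map_mul, map_mul]
    exact h _ (mem_algL.1 hg)
  · intro h g hg
    apply (trAlg n m d).injective
    rw [map_mul, map_mul, trAlg_trAlg]
    exact h _ (mem_algL.2 (by rwa [trAlg_trAlg]))

theorem exists_algR_apply_eq {f : Module.End K (VZ m n d)}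
    (hf : f ∈ Subalgebra.centralizer K (algL m n d : Set (Module.End K (VZ m n d))))
    {a : ZMat} (ha : IsXi m n d a) (hdiag : ∀ x y, a x y ≠ 0 → x = y) :
    ∃ r ∈ algR m n d, r (tZ m n d a) = f (tZ m n d a) := by
  rw [← mem_cyclicZ, sum_smul_tZ (f (tZ m n d a))]
  refine Submodule.sum_mem _ fun b hb => Submodule.smul_mem _ _ ?_
  refine tZ_mem_cyclicZ ha hdiag b.2 fun x => ?_
  refine apply_eq_zero_of_centralizer (trAlg_mem_centralizer.2 hf) ha.transpose
    ⟨trMat b.1, b.2.transpose⟩ ?_ x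
  rw [trAlg_apply, trZ_tZ]
  have : trZ m n d (f (tZ m n d a)) ⟨trMat b.1, b.2.transpose⟩ = f (tZ m n d a) b := by
    rw [trZ, Finsupp.domLCongr_apply, Finsupp.domCongr_apply]
    rfl
  exact fun h => Finsupp.mem_support_iff.1 hb (this.symm.trans h)

theorem exists_algL_apply_eq {f : Module.End K (VZ m n d)}
    (hf : f ∈ Subalgebra.centralizer K (algR m n d : Set (Module.End K (VZ m n d))))
    {a : ZMat} (ha : IsXi m n d a) (hdiag : ∀ x y, a x y ≠ 0 → x = y) :
    ∃ l ∈ algL m n d, l (tZ m n d a) = f (tZ m n d a) := by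
  have hf' : trAlg m n d f ∈
      Subalgebra.centralizer K (algL n m d : Set (Module.End K (VZ n m d))) := by
    rw [← trAlg_mem_centralizer, trAlg_trAlg]
    exact hf
  obtain ⟨r, hr, h⟩ := exists_algR_apply_eq hf' ha.transpose
    fun x y hxy => (hdiag y x hxy).symm
  refine ⟨trAlg n m d r, mem_algL.2 (by rwa [trAlg_trAlg]), ?_⟩
  rw [trAlg_apply, trZ_tZ, h, trAlg_apply, trZ_tZ, trZ_trZ]
  rfl

theorem commute_of_mem_centralizers (hmn : m ≤ n) {f g : Module.End K (VZ m n d)}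
    (hf : f ∈ Subalgebra.centralizer K (algL m n d : Set (Module.End K (VZ m n d))))
    (hg : g ∈ Subalgebra.centralizer K (algR m n d : Set (Module.End K (VZ m n d)))) :
    f * g = g * f := by
  let N : Submodule K (VZ m n d) :=
    ⨅ f : Subalgebra.centralizer K (algL m n d : Set (Module.End K (VZ m n d))),
      LinearMap.ker (f.1 * g - g * f.1)
  have hN : ∀ v, v ∈ N ↔ ∀ f ∈ Subalgebra.centralizer K
      (algL m n d : Set (Module.End K (VZ m n d))), f (g v) = g (f v) := by
    intro v
    simp [N, Submodule.mem_iInf, sub_eq_zero]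
  have htop : N = ⊤ := by
    refine eq_top_of_RZ_stable (fun i hi hi' v hv => ?_) (fun a ha hdiag => ?_)
      fun a ha x y hxy hx => ?_
    · rw [hN] at hv ⊢
      intro f hf
      have hR := RZ_mem_algR (m := m) (d := d) hi hi'
      have h1 : RZ m n d i (g v) = g (RZ m n d i v) :=
        congrArg (fun F : Module.End K (VZ m n d) => F v)
          ((Subalgebra.mem_centralizer_iff K).1 hg _ hR)
      have h2 := hv (f * RZ m n d i) (mul_mem hf ((Subalgebra.mem_centralizer_iff K).2
        fun l hl => (commute_of_mem_algR_algL hR hl).symm))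
      rw [Module.End.mul_apply, Module.End.mul_apply, h1] at h2
      exact h2
    · rw [hN]
      intro f hf
      obtain ⟨r, hr, hra⟩ := exists_algR_apply_eq hf ha hdiag
      obtain ⟨l, hl, hla⟩ := exists_algL_apply_eq hg ha hdiag
      have h1 := LinearMap.congr_fun ((Subalgebra.mem_centralizer_iff K).1 hf _ hl) (tZ m n d a)
      have h2 := LinearMap.congr_fun ((Subalgebra.mem_centralizer_iff K).1 hg _ hr) (tZ m n d a)
      have h3 := LinearMap.congr_fun (commute_of_mem_algR_algL hr hl).eq (tZ m n d a)
      simp only [Module.End.mul_apply] at h1 h2 h3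
      rw [← hla, ← h1, ← hra, ← h3, hla, h2]
    · exact absurd ⟨by have := (ha.supp _ _ hxy).1; omega,
        by have := (ha.supp _ _ hxy).1; omega⟩ hx
  refine LinearMap.ext fun v => ?_
  exact (hN v).1 (htop ▸ Submodule.mem_top) f hf

theorem centralizer_centralizer_algL :
    Subalgebra.centralizer K (Subalgebra.centralizer K
      (algL m n d : Set (Module.End K (VZ m n d))) : Set (Module.End K (VZ m n d))) =
        algL m n d := by
  ext f
  rw [mem_algL, ← centralizer_centralizer_algR, Subalgebra.mem_centralizer_iff,
    Subalgebra.mem_centralizer_iff]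
  constructor
  · intro h g hg
    apply (trAlg n m d).injective
    rw [map_mul, map_mul, trAlg_trAlg]
    refine h _ (trAlg_mem_centralizer.1 ?_)
    rwa [trAlg_trAlg]
  · intro h g hg
    apply (trAlg m n d).injective
    rw [map_mul, map_mul]
    exact h _ (trAlg_mem_centralizer.2 hg)

theorem centralizers_commute {f g : Module.End K (VZ m n d)}
    (hf : f ∈ Subalgebra.centralizer K (algL m n d : Set (Module.End K (VZ m n d))))
    (hg : g ∈ Subalgebra.centralizer K (algR m n d : Set (Module.End K (VZ m n d)))) :
    f * g = g * f := by
  rcases le_total m n with h | h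
  · exact commute_of_mem_centralizers h hf hg
  · apply (trAlg m n d).injective
    rw [map_mul, map_mul]
    refine (commute_of_mem_centralizers h ?_ (trAlg_mem_centralizer.2 hf)).symm
    rwa [← trAlg_mem_centralizer, trAlg_trAlg]

theorem centralizer_algR :
    Subalgebra.centralizer K (algR m n d : Set (Module.End K (VZ m n d))) = algL m n d := by
  refine le_antisymm (fun f hf => ?_) fun f hf => ?_
  · rw [← centralizer_centralizer_algL, Subalgebra.mem_centralizer_iff]
    exact fun g hg => centralizers_commute hg hf
  · exact (Subalgebra.mem_centralizer_iff K).2 fun g hg => commute_of_mem_algR_algL hg hf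

theorem centralizer_algL :
    Subalgebra.centralizer K (algL m n d : Set (Module.End K (VZ m n d))) = algR m n d := by
  rw [← centralizer_algR, centralizer_centralizer_algR]

end DoubleCentralizer

section Transport

variable {m n d : ℕ}

theorem mem_II_even {u : ℚ} : u ∈ II (2 * m) ↔ ∃ x ∈ Finset.Ico (-m : ℤ) m, (x : ℚ) + 1 / 2 = u := by
  rw [II, Finset.mem_image]
  constructor
  · rintro ⟨k, hk, rfl⟩
    rw [Finset.mem_range] at hk
    refine ⟨(k : ℤ) - m, Finset.mem_Ico.2 (by omega), ?_⟩
    push_cast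
    ring
  · rintro ⟨x, hx, rfl⟩
    rw [Finset.mem_Ico] at hx
    refine ⟨(x + m).toNat, Finset.mem_range.2 (by omega), ?_⟩
    have h : (((x + m).toNat : ℤ) : ℚ) = x + m := by
      rw [Int.toNat_of_nonneg (by omega)]
      push_cast
      rfl
    rw [Int.cast_natCast] at h
    rw [h]
    push_cast
    ring

theorem half_mem_II {x : ℤ} : (x : ℚ) + 1 / 2 ∈ II (2 * m) ↔ x ∈ Finset.Ico (-m : ℤ) m := by
  rw [mem_II_even]
  constructor
  · rintro ⟨y, hy, h⟩
    rwa [← Int.cast_injective (add_right_cancel h)]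
  · exact fun h => ⟨x, h, rfl⟩

theorem mem_II_odd (hm : 1 ≤ m) {u : ℚ} : u ∈ II (2 * m - 1) ↔ ∃ i : ℤ, -m < i ∧ i < m ∧ u = i := by
  obtain ⟨k, rfl⟩ := Nat.exists_eq_add_of_le' hm
  have hc : ((2 * (k + 1) - 1 : ℕ) : ℚ) = 2 * k + 1 := by
    rw [show 2 * (k + 1) - 1 = 2 * k + 1 by omega]
    push_cast
    ring
  rw [II, Finset.mem_image, hc]
  constructor
  · rintro ⟨l, hl, rfl⟩
    rw [Finset.mem_range] at hl
    refine ⟨(l : ℤ) - k, by omega, by omega, ?_⟩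
    push_cast
    ring
  · rintro ⟨i, hi, hi', rfl⟩
    refine ⟨(i + k).toNat, Finset.mem_range.2 (by omega), ?_⟩
    have h : (((i + k).toNat : ℤ) : ℚ) = i + k := by
      rw [Int.toNat_of_nonneg (by omega)]
      push_cast
      rfl
    rw [Int.cast_natCast] at h
    rw [h]
    ring

theorem sum_filter_II {M : Type*} [AddCommMonoid M] (f : ℚ → M) (p : ℚ → Prop) [DecidablePred p]
    (s : Finset ℤ) (hs : ∀ z : ℤ, z ∈ s ↔ ((-m : ℤ) ≤ z ∧ z < m) ∧ p (z + 1 / 2)) :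
    ∑ u ∈ (II (2 * m)).filter p, f u = ∑ x ∈ s, f (x + 1 / 2) := by
  symm
  refine Finset.sum_bij (fun x _ => (x : ℚ) + 1 / 2) (fun x hx => ?_) (fun x _ y _ h => ?_)
    (fun u hu => ?_) fun _ _ => rfl
  · rw [hs] at hx
    exact Finset.mem_filter.2 ⟨half_mem_II.2 (Finset.mem_Ico.2 hx.1), hx.2⟩
  · exact Int.cast_injective (add_right_cancel h)
  · rw [Finset.mem_filter, mem_II_even] at hu
    obtain ⟨⟨x, hx, rfl⟩, hp⟩ := hu
    exact ⟨x, (hs x).2 ⟨Finset.mem_Ico.1 hx, hp⟩, rfl⟩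

theorem sum_II {M : Type*} [AddCommMonoid M] (m : ℕ) (f : ℚ → M) :
    ∑ u ∈ II (2 * m), f u = ∑ x ∈ Finset.Ico (-m : ℤ) m, f (x + 1 / 2) := by
  rw [← sum_filter_II f (fun _ => True) _ (fun z => by rw [Finset.mem_Ico, and_true]),
    Finset.filter_true]

/-- The matrix with integer labels attached to a matrix with half-integer labels. -/
def matZ (A : Mat) : ZMat := fun x y => A (x + 1 / 2) (y + 1 / 2)

theorem neg_half (x : ℤ) : ((-1 - x : ℤ) : ℚ) + 1 / 2 = -(x + 1 / 2) := by
  push_cast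
  ring

theorem isXi_matZ {A : Mat} (h : A ∈ Xiι m n d) : IsXi m n d (matZ A) where
  nonneg x y := Int.natCast_nonneg _
  supp x y hxy := by
    have := h.1 _ _ (Int.natCast_ne_zero.1 hxy)
    rw [half_mem_II, half_mem_II, Finset.mem_Ico, Finset.mem_Ico] at this
    exact this
  symm x y := by
    rw [matZ, matZ, h.2.1, neg_half, neg_half]
  total := by
    have := congrArg (Nat.cast : ℕ → ℤ) h.2.2
    rw [sum_II] at this
    simp only [sum_II] at this
    push_cast at this
    exact this

theorem mem_Xiι_of_isXi_matZ {A : Mat}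
    (hs : ∀ u v, A u v ≠ 0 → u ∈ II (2 * m) ∧ v ∈ II (2 * n)) (h : IsXi m n d (matZ A)) :
    A ∈ Xiι m n d := by
  refine ⟨hs, fun u v => ?_, ?_⟩
  · by_cases huv : u ∈ II (2 * m) ∧ v ∈ II (2 * n)
    · obtain ⟨x, -, rfl⟩ := mem_II_even.1 huv.1
      obtain ⟨y, -, rfl⟩ := mem_II_even.1 huv.2
      have := h.symm x y
      rw [matZ, matZ, neg_half, neg_half] at this
      exact_mod_cast this
    · have h1 : A u v = 0 := by
        by_contra h0
        exact huv (hs u v h0)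
      have h2 : A (-u) (-v) = 0 := by
        by_contra h0
        have := hs _ _ h0
        exact huv ⟨neg_neg u ▸ II_neg this.1, neg_neg v ▸ II_neg this.2⟩
      rw [h1, h2]
  · have := h.total
    rw [sum_II]
    simp only [sum_II]
    simp only [matZ] at this
    exact_mod_cast this

theorem matZ_injective : Function.Injective fun A : Xiι m n d =>
    (⟨matZ A.1, isXi_matZ A.2⟩ : XiZ m n d) := by
  intro A B h
  have h' : matZ A.1 = matZ B.1 := congrArg Subtype.val h
  refine Subtype.ext (funext fun u => funext fun v => ?_)
  by_cases huv : u ∈ II (2 * m) ∧ v ∈ II (2 * n)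
  · obtain ⟨x, -, rfl⟩ := mem_II_even.1 huv.1
    obtain ⟨y, -, rfl⟩ := mem_II_even.1 huv.2
    have := congrFun (congrFun h' x) y
    exact Nat.cast_injective this
  · have key : ∀ C : Xiι m n d, C.1 u v = 0 := fun C => by
      by_contra h0
      exact huv (C.2.1 u v h0)
    rw [key, key]

theorem matZ_surjective : Function.Surjective fun A : Xiι m n d =>
    (⟨matZ A.1, isXi_matZ A.2⟩ : XiZ m n d) := by
  intro a
  let A : Mat := fun u v =>
    if u = ⌊u⌋ + 1 / 2 ∧ v = ⌊v⌋ + 1 / 2 then (a.1 ⌊u⌋ ⌊v⌋).toNat else 0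
  have hfl : ∀ x : ℤ, ⌊(x : ℚ) + 1 / 2⌋ = x := fun x => by
    rw [Int.floor_eq_iff]
    constructor <;> linarith
  have hA : matZ A = a.1 := by
    funext x y
    simp only [matZ, A, hfl, and_self, if_true]
    exact Int.toNat_of_nonneg (a.2.nonneg x y)
  have hmem : A ∈ Xiι m n d := by
    refine mem_Xiι_of_isXi_matZ (fun u v huv => ?_) (hA ▸ a.2)
    simp only [A] at huv
    split_ifs at huv with h
    · have := a.2.supp ⌊u⌋ ⌊v⌋ (by omega)
      rw [h.1, h.2, half_mem_II, half_mem_II, Finset.mem_Ico, Finset.mem_Ico]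
      exact this
    · exact absurd rfl huv
  exact ⟨⟨A, hmem⟩, Subtype.ext hA⟩

/-- The passage to integer labels on vectors. -/
def psiZ (m n d : ℕ) : FM (Xiι m n d) ≃ₗ[K] VZ m n d :=
  Finsupp.domLCongr (Equiv.ofBijective _ ⟨matZ_injective, matZ_surjective⟩)

theorem psiZ_tP {A : Mat} (h : A ∈ Xiι m n d) :
    psiZ m n d (tP (Xiι m n d) A) = tZ m n d (matZ A) := by
  rw [tP, dif_pos h, psiZ, Finsupp.domLCongr_single, tZ_of_isXi (isXi_matZ h)]
  rfl

theorem chiM_half (r c x y : ℤ) :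
    (chiM (r + 1 / 2) (c + 1 / 2) (x + 1 / 2) (y + 1 / 2) : ℤ) = chiZ r c x y := by
  have h1 : ∀ u v : ℤ, ((u : ℚ) + 1 / 2 = v + 1 / 2) ↔ u = v := fun u v => by
    rw [add_left_inj, Int.cast_inj]
  simp only [chiM, chiZ, ← neg_half, h1]
  push_cast
  rfl

theorem psiZ_tP_matMove {A : Mat} (h : A ∈ Xiι m n d) {r c x l : ℤ}
    (hr : (-m : ℤ) ≤ r ∧ r < m) (hc : (-n : ℤ) ≤ c ∧ c < n) (h0 : matZ A x l ≠ 0) :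
    psiZ m n d (tP (Xiι m n d) (matMove A (r + 1 / 2) (c + 1 / 2) (x + 1 / 2) (l + 1 / 2))) =
      tZ m n d (matZ A + (chiZ r c - chiZ x l)) := by
  have hXi := (isXi_matZ h).add_chiZ_sub_chiZ hr hc h0
  have hz : matZ (matMove A (r + 1 / 2) (c + 1 / 2) (x + 1 / 2) (l + 1 / 2)) =
      matZ A + (chiZ r c - chiZ x l) := by
    funext u v
    have hnn := hXi.nonneg u v
    simp only [Pi.add_apply, Pi.sub_apply, ← chiM_half, matZ, matMove] at hnn ⊢
    omega
  rw [← hz]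
  refine psiZ_tP (mem_Xiι_of_isXi_matZ (fun u v huv => ?_) (hz ▸ hXi))
  have hne : A u v ≠ 0 ∨ chiM (r + 1 / 2) (c + 1 / 2) u v ≠ 0 := by
    by_contra hcon
    simp only [not_or, not_not] at hcon
    refine huv ?_
    rw [matMove, hcon.1, hcon.2]
    exact Nat.zero_sub _
  have hr' := half_mem_II.2 (Finset.mem_Ico.2 hr)
  have hc' := half_mem_II.2 (Finset.mem_Ico.2 hc)
  rcases hne with hne | hne
  · exact h.1 u v hne
  · by_cases h1 : u = r + 1 / 2 ∧ v = c + 1 / 2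
    · rw [h1.1, h1.2]
      exact ⟨hr', hc'⟩
    · by_cases h2 : u = -(r + 1 / 2) ∧ v = -(c + 1 / 2)
      · rw [h2.1, h2.2]
        exact ⟨II_neg hr', II_neg hc'⟩
      · simp only [chiM, if_neg h1, if_neg h2] at hne
        exact absurd rfl hne

/-- The passage to integer labels on operators. -/
def phiZ (m n d : ℕ) : Module.End K (FM (Xiι m n d)) ≃ₐ[K] Module.End K (VZ m n d) :=
  (psiZ m n d).conjAlgEquiv K

theorem opOf_tP {P : Set Mat} (f : Mat → FM P) {A : Mat} (h : A ∈ P) :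
    opOf f (tP P A) = f A := by
  simp [opOf, tP, h]

theorem phiZ_eq {f : Module.End K (FM (Xiι m n d))} {g : Module.End K (VZ m n d)}
    (h : ∀ A ∈ Xiι m n d, psiZ m n d (f (tP (Xiι m n d) A)) = g (tZ m n d (matZ A))) :
    phiZ m n d f = g := by
  refine linearMap_ext_tZ fun a ha => ?_
  obtain ⟨A, hA⟩ := matZ_surjective ⟨a, ha⟩
  have hA' : matZ A.1 = a := congrArg Subtype.val hA
  rw [← hA', ← h A.1 A.2, ← psiZ_tP A.2]
  change psiZ m n d (f ((psiZ m n d).symm _)) = _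
  rw [LinearEquiv.symm_apply_apply]

end Transport

section Generators

variable {m n d : ℕ}

theorem psiZ_smul_tP_matMove {A : Mat} (h : A ∈ Xiι m n d) {r c x l : ℤ} (c₀ : K)
    (hr : (-m : ℤ) ≤ r ∧ r < m) (hc : (-n : ℤ) ≤ c ∧ c < n) :
    psiZ m n d ((c₀ * qint (A (x + 1 / 2) (l + 1 / 2))) •
      tP (Xiι m n d) (matMove A (r + 1 / 2) (c + 1 / 2) (x + 1 / 2) (l + 1 / 2))) =
      (c₀ * qint (matZ A x l)) • tZ m n d (matZ A + (chiZ r c - chiZ x l)) := by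
  rw [map_smul]
  change (c₀ * qint (matZ A x l)) • _ = _
  by_cases h0 : matZ A x l = 0
  · rw [h0, qint_zero, mul_zero, zero_smul, zero_smul]
  · rw [psiZ_tP_matMove h hr hc h0]

theorem sum_filter_lt (x : ℤ) (f : ℚ → ℤ) (hx : (-m : ℤ) ≤ x) :
    ∑ k ∈ (II (2 * m)).filter (fun k => (x : ℚ) + 1 / 2 < k), f k =
      ∑ z ∈ Finset.Ioo x m, f (z + 1 / 2) := by
  refine sum_filter_II f _ _ fun z => ?_
  rw [Finset.mem_Ioo, add_lt_add_iff_right, Int.cast_lt]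
  omega

theorem sum_filter_le (x : ℤ) (f : ℚ → ℤ) (hx : (-m : ℤ) ≤ x) :
    ∑ k ∈ (II (2 * m)).filter (fun k => (x : ℚ) + 1 / 2 ≤ k), f k =
      ∑ z ∈ Finset.Ico x m, f (z + 1 / 2) := by
  refine sum_filter_II f _ _ fun z => ?_
  rw [Finset.mem_Ico, add_le_add_iff_right, Int.cast_le]
  omega

theorem half_pos_iff (z : ℤ) : (0 : ℚ) < z + 1 / 2 ↔ 0 ≤ z := by
  constructor
  · intro h
    have : ((-1 : ℤ) : ℚ) < z := by push_cast; linarith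
    have := Int.cast_lt.1 this
    omega
  · intro h
    have : (0 : ℚ) ≤ z := by exact_mod_cast h
    linarith

theorem half_neg_iff (z : ℤ) : (z : ℚ) + 1 / 2 < 0 ↔ z < 0 := by
  rw [← not_le, ← not_le, not_iff_not]
  constructor
  · intro h
    refine (half_pos_iff z).1 (lt_of_le_of_ne h fun h0 => ?_)
    have : ((2 * z + 1 : ℤ) : ℚ) = ((0 : ℤ) : ℚ) := by push_cast; linarith
    have := Int.cast_injective this
    omega
  · exact fun h => ((half_pos_iff z).2 h).le

theorem sum_filter_pos (f : ℚ → ℤ) :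
    ∑ k ∈ (II (2 * m)).filter (fun k => 0 < k), f k = ∑ z ∈ Finset.Ico (0 : ℤ) m, f (z + 1 / 2) := by
  refine sum_filter_II f _ _ fun z => ?_
  rw [Finset.mem_Ico, half_pos_iff]
  omega

theorem int_sub_half (i : ℤ) : (i : ℚ) - 1 / 2 = ((i - 1 : ℤ) : ℚ) + 1 / 2 := by
  push_cast
  ring

theorem phiZ_BRι {i : ℤ} (hi : (-n : ℤ) < i) (hi' : i < n) (h0 : i ≠ 0) :
    phiZ m n d (BRι m (Xiι m n d) i) = RZ m n d i := by
  refine phiZ_eq fun A hA => ?_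
  rw [BRι, opOf_tP _ hA, RZ_tZ i (isXi_matZ hA), sum_II, map_sum, idxZ, Finset.sum_insertNone]
  simp only [coefZ, if_neg h0, zero_smul, zero_add]
  refine Finset.sum_congr rfl fun x hx => ?_
  rw [Finset.mem_Ico] at hx
  rw [sum_filter_lt x _ hx.1, int_sub_half, psiZ_smul_tP_matMove hA _ hx (by omega), wtZ,
    if_neg fun h => h0 h.1, add_zero]
  rfl

theorem phiZ_BR0ι (hn : 1 ≤ n) : phiZ m n d (BR0ι m (Xiι m n d)) = RZ m n d 0 := by
  refine phiZ_eq fun A hA => ?_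
  rw [BR0ι, opOf_tP _ hA, RZ_tZ 0 (isXi_matZ hA)]
  generalize hp' : (-(1 / 2) : ℚ) = p'
  generalize hp : (1 / 2 : ℚ) = p
  have h0 : p = ((0 : ℤ) : ℚ) + 1 / 2 := by rw [← hp]; norm_num
  have h1 : p' = ((-1 : ℤ) : ℚ) + 1 / 2 := by rw [← hp']; norm_num
  rw [sum_II, map_add, map_sum, idxZ,
    Finset.sum_insertNone, add_comm]
  congr 1
  · rw [sum_filter_pos, map_smul, psiZ_tP hA, h0, h1]
    simp only [coefZ, stepZ, add_zero, if_true]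
    rfl
  · refine Finset.sum_congr rfl fun x hx => ?_
    rw [Finset.mem_Ico] at hx
    rw [sum_filter_lt x _ hx.1, h0, h1]
    rw [psiZ_smul_tP_matMove hA _ hx (by omega), coefZ, wtZ]
    simp only [half_neg_iff, true_and]
    rfl

theorem phiZ_dRι (r e : ℤ) : phiZ m n d (dRι m (Xiι m n d) (r + 1 / 2) e) = CZ m n d r e := by
  refine phiZ_eq fun A hA => ?_
  rw [dRι, opOf_tP _ hA, CZ, diagZ_tZ _ (isXi_matZ hA), map_smul, psiZ_tP hA, sum_II]
  rfl

theorem phiZ_dLι (r e : ℤ) :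
    phiZ m n d (dLι n (Xiι m n d) (r + 1 / 2) e) = trAlg n m d (CZ n m d r e) := by
  refine phiZ_eq fun A hA => ?_
  rw [dLι, opOf_tP _ hA, CZ, trAlg_diagZ, diagZ_tZ _ (isXi_matZ hA), map_smul, psiZ_tP hA, sum_II]
  rfl

/-- The left operators in transposed integer labels. -/
def LadjZ (m n d : ℕ) (i : ℤ) : Module.End K (VZ m n d) :=
  RZ m n d (-i) * diagZ m n d (adjScale m i)

theorem LadjZ_tZ {b : ZMat} (hb : IsXi m n d b) {i : ℤ} (f : ℤ → ℤ)
    (hf : ∀ y, (-m : ℤ) ≤ y → y < m → f y = (∑ z ∈ Finset.Ico y m, (b z i - b z (i - 1))) +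
      if i = 0 then (if 0 ≤ y then 1 else 0) else 1) :
    LadjZ m n d i (tZ m n d b) = (if i = 0 then q ^ wtDiagZ m b else 0) • tZ m n d b +
      ∑ y ∈ Finset.Ico (-m : ℤ) m,
        (q ^ f y * qint (b y (i - 1))) • tZ m n d (b + (chiZ y i - chiZ y (i - 1))) := by
  rw [LadjZ, Module.End.mul_apply, diagZ_tZ _ hb, map_smul, RZ_tZ _ hb, idxZ,
    Finset.sum_insertNone, smul_add, Finset.smul_sum, ← sum_Ico_neg]
  congr 1
  · by_cases h0 : i = 0
    · subst h0
      simp [coefZ, stepZ, adjScale]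
    · simp [coefZ, h0]
  · refine Finset.sum_congr rfl fun y hy => ?_
    rw [Finset.mem_Ico] at hy
    have hstep : stepZ (-i) (some (-1 - y)) = chiZ y i - chiZ y (i - 1) := by
      rw [stepZ, moveZ, ← chiZ_neg y i, ← chiZ_neg y (i - 1)]
      congr 2 <;> ring
    have hent : b (-1 - y) (-i) = b y (i - 1) := by
      rw [hb.symm y (i - 1)]
      congr 1
      ring
    rw [hstep, coefZ, hent, smul_smul, hb.wtZ_neg i hy.1 hy.2, hf y hy.1 hy.2, ← mul_assoc]
    congr 2
    have hsum : ∑ z ∈ Finset.Ico y m, (b z i - b z (i - 1)) =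
        (b y i - b y (i - 1)) + ∑ z ∈ Finset.Ioo y m, (b z i - b z (i - 1)) := by
      rw [← Finset.Ioo_insert_left hy.2, Finset.sum_insert Finset.left_notMem_Ioo]
    rw [hsum, adjScale]
    by_cases h0 : i = 0
    · subst h0
      have := hb.colZ_neg 0
      simp only [if_true, true_and, one_mul, zero_sub]
      congr 1
      rw [show (-1 : ℤ) = -1 - 0 from rfl, this]
      ring
    · rw [if_neg h0, if_neg h0, if_neg fun h => h0 h.1, ← zpow_add₀ q_ne_zero]
      congr 1
      ring

theorem trMat_add_matZ (A : Mat) (y i : ℤ) :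
    trMat (trMat (matZ A) + (chiZ y i - chiZ y (i - 1))) =
      matZ A + (chiZ i y - chiZ (i - 1) y) := by
  rw [← trMat_chiZ i y, ← trMat_chiZ (i - 1) y]
  rfl

theorem phiZ_BLι {i : ℤ} (hi : (-m : ℤ) < i) (hi' : i < m) (h0 : i ≠ 0) :
    phiZ m n d (BLι n (Xiι m n d) i) = trAlg n m d (LadjZ n m d i) := by
  refine phiZ_eq fun A hA => ?_
  rw [trAlg_apply, trZ_tZ, LadjZ_tZ (isXi_matZ hA).transpose
    (fun y => (∑ z ∈ Finset.Ico y n, (trMat (matZ A) z i - trMat (matZ A) z (i - 1))) + 1)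
    fun y _ _ => by rw [if_neg h0], if_neg h0, zero_smul, zero_add, map_sum, BLι, opOf_tP _ hA,
    sum_II, map_sum]
  refine Finset.sum_congr rfl fun y hy => ?_
  rw [Finset.mem_Ico] at hy
  rw [sum_filter_le y _ hy.1, int_sub_half, psiZ_smul_tP_matMove hA _ (by omega) hy, map_smul, trZ_tZ,
    trMat_add_matZ]
  rfl

theorem phiZ_BL0ι (hm : 1 ≤ m) :
    phiZ m n d (BL0ι n (Xiι m n d)) = trAlg n m d (LadjZ n m d 0) := by
  refine phiZ_eq fun A hA => ?_
  rw [trAlg_apply, trZ_tZ, LadjZ_tZ (isXi_matZ hA).transpose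
    (fun y => (∑ z ∈ Finset.Ico y n, (trMat (matZ A) z 0 - trMat (matZ A) z (-1))) +
      if 0 ≤ y then 1 else 0)
    fun y _ _ => by rw [if_pos rfl, zero_sub], if_pos rfl, map_add, map_sum, BL0ι, opOf_tP _ hA]
  generalize hp' : (-(1 / 2) : ℚ) = p'
  generalize hp : (1 / 2 : ℚ) = p
  have h0 : p = ((0 : ℤ) : ℚ) + 1 / 2 := by rw [← hp]; norm_num
  have h1 : p' = ((-1 : ℤ) : ℚ) + 1 / 2 := by rw [← hp']; norm_num
  rw [sum_II, map_add, map_sum, add_comm]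
  congr 1
  · rw [sum_filter_pos, map_smul, map_smul, psiZ_tP hA, h0, h1, trZ_tZ]
    rfl
  · refine Finset.sum_congr rfl fun y hy => ?_
    rw [Finset.mem_Ico] at hy
    rw [sum_filter_le y _ hy.1, h0, h1, psiZ_smul_tP_matMove hA _ (by omega) hy,
      map_smul, trZ_tZ, trMat_add_matZ]
    simp only [half_pos_iff]
    rfl

end Generators

section DoubleCentralizer

variable {m n d : ℕ}

theorem image_gensRι (hn : 1 ≤ n) : phiZ m n d '' gensRι m n d = gensZ m n d := by
  have hR : ∀ i : ℤ, (-n : ℤ) < i → i < n → phiZ m n d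
      (if (i : ℚ) = 0 then BR0ι m (Xiι m n d) else BRι m (Xiι m n d) i) = RZ m n d i := by
    intro i hi hi'
    by_cases h0 : i = 0
    · subst h0
      rw [if_pos Int.cast_zero, phiZ_BR0ι hn]
    · rw [if_neg (Int.cast_ne_zero.2 h0), phiZ_BRι hi hi' h0]
  apply Set.Subset.antisymm
  · rintro _ ⟨f, ⟨u, hu, rfl⟩ | ⟨u, hu, h0, hf⟩, rfl⟩
    · obtain ⟨i, hi, hi', rfl⟩ := (mem_II_odd hn).1 hu
      exact Or.inl ⟨i, hi, hi', hR i hi hi'⟩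
    · obtain ⟨r, hr, rfl⟩ := mem_II_even.1 hu
      refine Or.inr ⟨r, (half_pos_iff r).1 h0, (Finset.mem_Ico.1 hr).2, ?_⟩
      rcases hf with rfl | rfl
      · exact Or.inl (phiZ_dRι r 1)
      · exact Or.inr (phiZ_dRι r (-1))
  · rintro _ (⟨i, hi, hi', rfl⟩ | ⟨r, hr, hr', hf⟩)
    · exact ⟨_, Or.inl ⟨i, (mem_II_odd hn).2 ⟨i, hi, hi', rfl⟩, rfl⟩, hR i hi hi'⟩
    · have hr'' := half_mem_II.2 (Finset.mem_Ico.2 ⟨by omega, hr'⟩)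
      rcases hf with rfl | rfl
      · exact ⟨_, Or.inr ⟨_, hr'', (half_pos_iff r).2 hr, Or.inl rfl⟩, phiZ_dRι r 1⟩
      · exact ⟨_, Or.inr ⟨_, hr'', (half_pos_iff r).2 hr, Or.inr rfl⟩, phiZ_dRι r (-1)⟩

/-- The left operators as generators of the algebra of right operators of the transposed
space. -/
def gensAdjZ (m n d : ℕ) : Set (Module.End K (VZ m n d)) :=
  {O | (∃ i : ℤ, -n < i ∧ i < n ∧ O = LadjZ m n d i) ∨
    (∃ r : ℤ, 0 ≤ r ∧ r < n ∧ (O = CZ m n d r 1 ∨ O = CZ m n d r (-1)))}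

theorem image_gensLι (hm : 1 ≤ m) :
    phiZ m n d '' gensLι m n d = trAlg n m d '' gensAdjZ n m d := by
  have hL : ∀ i : ℤ, (-m : ℤ) < i → i < m → phiZ m n d
      (if (i : ℚ) = 0 then BL0ι n (Xiι m n d) else BLι n (Xiι m n d) i) =
        trAlg n m d (LadjZ n m d i) := by
    intro i hi hi'
    by_cases h0 : i = 0
    · subst h0
      rw [if_pos Int.cast_zero, phiZ_BL0ι hm]
    · rw [if_neg (Int.cast_ne_zero.2 h0), phiZ_BLι hi hi' h0]
  apply Set.Subset.antisymm
  · rintro _ ⟨f, ⟨u, hu, rfl⟩ | ⟨u, hu, h0, hf⟩, rfl⟩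
    · obtain ⟨i, hi, hi', rfl⟩ := (mem_II_odd hm).1 hu
      exact ⟨_, Or.inl ⟨i, hi, hi', rfl⟩, (hL i hi hi').symm⟩
    · obtain ⟨r, hr, rfl⟩ := mem_II_even.1 hu
      have h0' := (half_pos_iff r).1 h0
      have hr' := (Finset.mem_Ico.1 hr).2
      rcases hf with rfl | rfl
      · exact ⟨_, Or.inr ⟨r, h0', hr', Or.inl rfl⟩, (phiZ_dLι r 1).symm⟩
      · exact ⟨_, Or.inr ⟨r, h0', hr', Or.inr rfl⟩, (phiZ_dLι r (-1)).symm⟩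
  · rintro _ ⟨_, ⟨i, hi, hi', rfl⟩ | ⟨r, hr, hr', hf⟩, rfl⟩
    · exact ⟨_, Or.inl ⟨i, (mem_II_odd hm).2 ⟨i, hi, hi', rfl⟩, rfl⟩, hL i hi hi'⟩
    · have hr'' := half_mem_II.2 (Finset.mem_Ico.2 ⟨by omega, hr'⟩)
      rcases hf with rfl | rfl
      · exact ⟨_, Or.inr ⟨_, hr'', (half_pos_iff r).2 hr, Or.inl rfl⟩, phiZ_dLι r 1⟩
      · exact ⟨_, Or.inr ⟨_, hr'', (half_pos_iff r).2 hr, Or.inr rfl⟩, phiZ_dLι r (-1)⟩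

theorem diagZ_one : diagZ m n d (fun _ => 1) = 1 :=
  linearMap_ext_tZ fun a ha => by rw [diagZ_tZ _ ha, one_smul, Module.End.one_apply]

theorem adjScale_ne_zero (i : ℤ) (b : ZMat) : adjScale m i b ≠ 0 := by
  rw [adjScale]
  split_ifs
  · exact one_ne_zero
  · exact zpow_ne_zero _ q_ne_zero

theorem diagZ_adjScale_inv_mem {S : Subalgebra K (Module.End K (VZ m n d))}
    (hS : ∀ r e : ℤ, (-n : ℤ) ≤ r → r < n → e = 1 ∨ e = -1 → CZ m n d r e ∈ S) {i : ℤ}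
    (hi : (-n : ℤ) < i) (hi' : i < n) :
    diagZ m n d (fun b => (adjScale m i b)⁻¹) ∈ S := by
  by_cases h0 : i = 0
  · subst h0
    simp only [adjScale, if_true, inv_one]
    rw [diagZ_one]
    exact one_mem S
  · have : diagZ m n d (fun b => (adjScale m i b)⁻¹) =
        (q⁻¹ : K) • (CZ m n d (i - 1) 1 * CZ m n d i (-1)) := by
      refine linearMap_ext_tZ fun a ha => ?_
      rw [CZ, CZ, diagZ_mul, LinearMap.smul_apply, diagZ_tZ _ ha, diagZ_tZ _ ha, smul_smul,
        adjScale, if_neg h0, ← zpow_neg, ← zpow_neg_one, ← zpow_add₀ q_ne_zero,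
        ← zpow_add₀ q_ne_zero]
      congr 2
      ring
    rw [this]
    exact S.smul_mem (S.mul_mem (hS _ _ (by omega) (by omega) (Or.inl rfl))
      (hS _ _ (by omega) hi' (Or.inr rfl))) _

theorem adjoin_gensAdjZ : Algebra.adjoin K (gensAdjZ m n d) = algR m n d := by
  apply le_antisymm
  · rw [Algebra.adjoin_le_iff]
    rintro _ (⟨i, hi, hi', rfl⟩ | hC)
    · exact mul_mem (RZ_mem_algR (by omega) (by omega)) (diagZ_adjScale hi hi')
    · exact Algebra.subset_adjoin (Or.inr hC)
  · rw [algR, Algebra.adjoin_le_iff]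
    rintro _ (⟨i, hi, hi', rfl⟩ | hC)
    · have hL : LadjZ m n d (-i) ∈ Algebra.adjoin K (gensAdjZ m n d) :=
        Algebra.subset_adjoin (Or.inl ⟨-i, by omega, by omega, rfl⟩)
      have hC : ∀ r e : ℤ, (-n : ℤ) ≤ r → r < n → e = 1 ∨ e = -1 →
          CZ m n d r e ∈ Algebra.adjoin K (gensAdjZ m n d) := by
        intro r e hr hr' he
        apply Algebra.subset_adjoin
        right
        by_cases h : 0 ≤ r
        · exact ⟨r, h, hr', by rcases he with rfl | rfl <;> simp⟩
        · exact ⟨-1 - r, by omega, by omega, by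
            rw [CZ_neg, CZ_neg]; rcases he with rfl | rfl <;> simp⟩
      have hinv := diagZ_adjScale_inv_mem (m := m) hC (i := -i) (by omega) (by omega)
      have h := mul_mem hL hinv
      rw [LadjZ, mul_assoc, diagZ_mul, neg_neg] at h
      simp only [mul_inv_cancel₀ (adjScale_ne_zero _ _)] at h
      rwa [diagZ_one, mul_one] at h
    · exact Algebra.subset_adjoin (Or.inr hC)

theorem map_adjoin_gensRι (hn : 1 ≤ n) :
    (Algebra.adjoin K (gensRι m n d)).map (phiZ m n d).toAlgHom = algR m n d := by
  rw [AlgHom.map_adjoin, algR, ← image_gensRι hn]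
  rfl

theorem map_adjoin_gensLι (hm : 1 ≤ m) :
    (Algebra.adjoin K (gensLι m n d)).map (phiZ m n d).toAlgHom = algL m n d := by
  rw [AlgHom.map_adjoin, algL, ← adjoin_gensAdjZ, AlgHom.map_adjoin]
  exact congrArg _ (image_gensLι hm)

theorem centralizer_eq_of_map {A B : Type*} [Semiring A] [Semiring B] [Algebra K A] [Algebra K B]
    (φ : A ≃ₐ[K] B) {S T : Subalgebra K A}
    (h : Subalgebra.centralizer K (S.map φ.toAlgHom : Set B) = T.map φ.toAlgHom) :
    Subalgebra.centralizer K (S : Set A) = T := by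
  ext f
  have hT : f ∈ T ↔ φ f ∈ T.map φ.toAlgHom := by
    rw [Subalgebra.mem_map]
    constructor
    · exact fun hf => ⟨f, hf, rfl⟩
    · rintro ⟨g, hg, hgf⟩
      rwa [← φ.injective hgf]
  rw [hT, ← h, Subalgebra.mem_centralizer_iff, Subalgebra.mem_centralizer_iff]
  constructor
  · rintro hf _ ⟨g, hg, rfl⟩
    change φ g * φ f = φ f * φ g
    rw [← map_mul, hf g hg, map_mul]
  · intro hf g hg
    apply φ.injective
    rw [map_mul, map_mul]
    exact hf _ ⟨g, hg, rfl⟩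

end DoubleCentralizer

theorem stmt9 (m n d : ℕ) (hm : 1 ≤ m) (hn : 1 ≤ n) :
    -- (1) every left operator commutes with every right operator
    (∀ a ∈ gensLι m n d, ∀ b ∈ gensRι m n d, Commute a b) ∧
    -- (2) the double centralizer property
    Subalgebra.centralizer K
        ((Algebra.adjoin K (gensLι m n d) : Subalgebra K (Module.End K (FM (Xiι m n d)))) : Set (Module.End K (FM (Xiι m n d))))
      = Algebra.adjoin K (gensRι m n d) ∧
    Subalgebra.centralizer K
        ((Algebra.adjoin K (gensRι m n d) : Subalgebra K (Module.End K (FM (Xiι m n d)))) : Set (Module.End K (FM (Xiι m n d))))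
      = Algebra.adjoin K (gensLι m n d) := by
  have hL : Subalgebra.centralizer K
      ((Algebra.adjoin K (gensLι m n d) : Subalgebra K _) : Set (Module.End K (FM (Xiι m n d)))) =
        Algebra.adjoin K (gensRι m n d) := by
    apply centralizer_eq_of_map (phiZ m n d)
    rw [map_adjoin_gensLι hm, map_adjoin_gensRι hn, centralizer_algL]
  have hR : Subalgebra.centralizer K
      ((Algebra.adjoin K (gensRι m n d) : Subalgebra K _) : Set (Module.End K (FM (Xiι m n d)))) =
        Algebra.adjoin K (gensLι m n d) := by
    apply centralizer_eq_of_map (phiZ m n d)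
    rw [map_adjoin_gensLι hm, map_adjoin_gensRι hn, centralizer_algR]
  refine ⟨fun a ha b hb => ?_, hL, hR⟩
  have hb' := Algebra.subset_adjoin (R := K) hb
  rw [← hL, SetLike.mem_coe, Subalgebra.mem_centralizer_iff] at hb'
  exact hb' a (Algebra.subset_adjoin ha)

end
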